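/- Let (m_n)_{n≥1} be a sequence of integers with m_n ≥ 2, and for t ≥ 0 let H_{n,t} be the continuous-time m_n-shuffle distribution. Then: (i) there exists a sequence (s_n) of positive reals such that for every ε ∈ (0,1), ‖H_{n,u_n} − U_n‖_TV → 0 for every choice of times u_n ≥ (1+ε)·s_n and ‖H_{n,u_n} − U_n‖_TV → 1 for every choice of times 0 ≤ u_n ≤ (1−ε)·s_n, if and only if lim_{n→∞} (log n)/(log m_n) = ∞. (ii) Moreover, if lim_{n→∞} (log n)/(log m_n) = ∞ then, with t_n = (3·log n)/(2·log m_n): lim_{c→+∞} limsup_{n→∞} ‖H_{n, t_n + c·√t_n} − U_n‖_TV = 0, lim_{c→+∞} liminf_{n→∞} ‖H_{n, max(t_n − c·√t_n, 0)} − U_n‖_TV = 1, and for every c > 0, liminf_{n→∞} ‖H_{n, t_n + c·√t_n} − U_n‖_TV > 0 and limsup_{n→∞} ‖H_{n, max(t_n − c·√t_n, 0)} − U_n‖_TV < 1. -/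

import Mathlib

open Filter MeasureTheory
open scoped BigOperators NNReal ENNReal

noncomputable section

/-- The value of `σ⁻¹` at position `i` (0-indexed), as a natural number; `0` out of range. -/
def invAt (n : ℕ) (σ : Equiv.Perm (Fin n)) (i : ℕ) : ℕ :=
  if h : i < n then ((σ⁻¹ ⟨i, h⟩ : Fin n) : ℕ) else 0

/-- The number of rising sequences of a permutation: one plus the number of descents
of its inverse. -/
def rSeq (n : ℕ) (σ : Equiv.Perm (Fin n)) : ℕ :=
  1 + ((Finset.range (n - 1)).filter fun i => invAt n σ (i + 1) < invAt n σ i).card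

/-- The `m`-shuffle distribution on `S_n`:  `Q_{n,m}(σ) = m^{-n} C(n + m - r(σ), n)`. -/
def Qs (n m : ℕ) (σ : Equiv.Perm (Fin n)) : ℝ :=
  ((m : ℝ) ^ n)⁻¹ * (Nat.choose (n + m - rSeq n σ) n : ℝ)

/-- The uniform distribution on `S_n`. -/
def Us (n : ℕ) (_ : Equiv.Perm (Fin n)) : ℝ := (n.factorial : ℝ)⁻¹

/-- Total variation distance between two probability distributions on `S_n`. -/
def tv (n : ℕ) (μ ν : Equiv.Perm (Fin n) → ℝ) : ℝ :=
  (1 / 2) * ∑ σ : Equiv.Perm (Fin n), |μ σ - ν σ|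

/-- Convolution of two distributions on `S_n`. -/
def convol (n : ℕ) (μ ν : Equiv.Perm (Fin n) → ℝ) : Equiv.Perm (Fin n) → ℝ :=
  fun σ => ∑ τ : Equiv.Perm (Fin n), μ (σ * τ⁻¹) * ν τ

/-- `k`-fold convolution power; the `0`-th power is the point mass at the identity. -/
def iterConv (n : ℕ) (μ : Equiv.Perm (Fin n) → ℝ) : ℕ → Equiv.Perm (Fin n) → ℝ
  | 0 => fun σ => if σ = 1 then 1 else 0
  | k + 1 => convol n μ (iterConv n μ k)

/-- `Ψ(x) = (2π)^{-1/2} ∫_{-x/(4√3)}^{x/(4√3)} e^{-t²/2} dt`. -/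
def Psi (x : ℝ) : ℝ :=
  (Real.sqrt (2 * Real.pi))⁻¹ *
    ∫ t in (-(x / (4 * Real.sqrt 3)))..(x / (4 * Real.sqrt 3)), Real.exp (-t ^ 2 / 2)

/-- The `p`-shuffle distribution on `S_n` for a probability `p` on the positive integers. -/
def Qp (n : ℕ) (p : ℕ → ℝ) (σ : Equiv.Perm (Fin n)) : ℝ := ∑' m : ℕ, p m * Qs n m σ

/-- Continuous-time `m`-shuffle distribution at time `t`:
`H_{n,t}(σ) = e^{-t} Σ_k (t^k/k!) Q_{n,m}^k(σ)`. -/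
def Hm (n m : ℕ) (t : ℝ) (σ : Equiv.Perm (Fin n)) : ℝ :=
  Real.exp (-t) * ∑' k : ℕ, t ^ k / (k.factorial : ℝ) * iterConv n (Qs n m) k σ

/-- The number of words in `M` letters whose stable sorting permutation is `π`. -/
def sortCount (n M : ℕ) (π : Equiv.Perm (Fin n)) : ℕ :=
  (Finset.univ.filter fun w : Fin n → Fin M => Tuple.sort w = π).card

/-- The number of descents of `σ⁻¹` among the first `i` positions. -/
def invDescents (n : ℕ) (σ : Equiv.Perm (Fin n)) (i : ℕ) : ℕ :=
  ((Finset.range i).filter fun j => invAt n σ (j + 1) < invAt n σ j).card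

lemma invDescents_succ (n : ℕ) (σ : Equiv.Perm (Fin n)) (i : ℕ) :
    invDescents n σ (i + 1) =
      invDescents n σ i + if invAt n σ (i + 1) < invAt n σ i then 1 else 0 := by
  unfold invDescents
  rw [Finset.range_add_one, Finset.filter_insert]
  split_ifs <;> simp

lemma invDescents_le (n : ℕ) (σ : Equiv.Perm (Fin n)) (i : ℕ) : invDescents n σ i ≤ i :=
  (Finset.card_filter_le _ _).trans (by simp)

lemma rSeq_eq (n : ℕ) (σ : Equiv.Perm (Fin n)) : rSeq n σ = 1 + invDescents n σ (n - 1) := rfl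

lemma one_le_rSeq (n : ℕ) (σ : Equiv.Perm (Fin n)) : 1 ≤ rSeq n σ := by
  rw [rSeq_eq]; omega

lemma rSeq_le (n : ℕ) (σ : Equiv.Perm (Fin (n + 1))) : rSeq (n + 1) σ ≤ n + 1 := by
  have := invDescents_le (n + 1) σ n
  rw [rSeq_eq, Nat.add_sub_cancel]; omega

lemma invAt_castSucc {n : ℕ} (σ : Equiv.Perm (Fin (n + 1))) (i : Fin n) :
    invAt (n + 1) σ i = σ⁻¹ i.castSucc := by
  unfold invAt
  rw [dif_pos (by omega)]; rfl

lemma invAt_succ {n : ℕ} (σ : Equiv.Perm (Fin (n + 1))) (i : Fin n) :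
    invAt (n + 1) σ (i + 1) = σ⁻¹ i.succ := by
  unfold invAt
  rw [dif_pos (by omega)]; rfl

/-- The sequence of letters `v` is the sorted version of a word with sorting permutation `σ⁻¹`
iff consecutive letters increase weakly, and strictly at the descents of `σ⁻¹`. -/
lemma sort_eq_iff_invDescents {n M : ℕ} (σ : Equiv.Perm (Fin (n + 1))) (w : Fin (n + 1) → Fin M) :
    Tuple.sort w = σ⁻¹ ↔ ∀ i : Fin n, (w (σ⁻¹ i.castSucc) : ℕ) + invDescents (n + 1) σ (i + 1) ≤
      w (σ⁻¹ i.succ) + invDescents (n + 1) σ i := by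
  have key : Tuple.sort w = σ⁻¹ ↔ StrictMono fun i => toLex (w (σ⁻¹ i), σ⁻¹ i) := by
    rw [eq_comm, Tuple.eq_sort_iff]
    constructor
    · rintro ⟨h1, h2⟩ i j hij
      rw [Prod.Lex.toLex_lt_toLex]
      rcases (h1 hij.le).lt_or_eq with h | h
      · exact Or.inl h
      · exact Or.inr ⟨h, h2 i j hij h⟩
    · intro h
      refine ⟨fun i j hij => ?_, fun i j hij heq => ?_⟩
      · have := h.monotone hij
        simp only [Prod.Lex.toLex_le_toLex] at this
        rcases this with h | h
        · exact h.le
        · exact h.1.le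
      · have := h hij
        simp only [Prod.Lex.toLex_lt_toLex] at this
        rcases this with h | h
        · exact absurd heq h.ne
        · exact h.2
  rw [key, Fin.strictMono_iff_lt_succ]
  refine forall_congr' fun i => ?_
  have hne : (σ⁻¹ i.castSucc : ℕ) ≠ σ⁻¹ i.succ := by
    rw [Ne, Fin.val_inj, EmbeddingLike.apply_eq_iff_eq]
    exact i.castSucc_lt_succ.ne
  rw [Prod.Lex.toLex_lt_toLex, invDescents_succ, invAt_castSucc, invAt_succ]
  simp only [Fin.lt_def, Fin.ext_iff]
  split_ifs <;> omega

lemma card_orderEmb_fin (n K : ℕ) : Nat.card (Fin n ↪o Fin K) = K.choose n := by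
  rw [Nat.card_congr Set.powersetCard.ofFinEmbEquiv, Set.powersetCard.card]
  simp

lemma le_apply_of_strictMono {n : ℕ} {g : Fin n → ℕ} (hg : StrictMono g) (i : Fin n) :
    (i : ℕ) ≤ g i := by
  obtain ⟨i, hi⟩ := i
  induction i with
  | zero => simp
  | succ k ih =>
    have h1 := ih (by omega)
    have h2 := hg (show (⟨k, by omega⟩ : Fin n) < ⟨k + 1, hi⟩ from by simp)
    simp only at *
    omega

lemma strictMono_sorted_shift {n M : ℕ} (σ : Equiv.Perm (Fin (n + 1))) {w : Fin (n + 1) → Fin M}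
    (hw : Tuple.sort w = σ⁻¹) :
    StrictMono fun i : Fin (n + 1) => (w (σ⁻¹ i) : ℕ) + i - invDescents (n + 1) σ i := by
  rw [sort_eq_iff_invDescents] at hw
  rw [Fin.strictMono_iff_lt_succ]
  intro i
  have h1 := hw i
  have h2 := invDescents_le (n + 1) σ i
  have h3 := invDescents_le (n + 1) σ (i + 1)
  simp only [Fin.val_castSucc, Fin.val_succ]
  omega

lemma sorted_shift_lt {n M : ℕ} (σ : Equiv.Perm (Fin (n + 1))) {w : Fin (n + 1) → Fin M}
    (hw : Tuple.sort w = σ⁻¹) (i : Fin (n + 1)) :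
    (w (σ⁻¹ i) : ℕ) + i - invDescents (n + 1) σ i < n + 1 + M - rSeq (n + 1) σ := by
  have h1 := (strictMono_sorted_shift σ hw).monotone (Fin.le_last i)
  have h2 := (w (σ⁻¹ (Fin.last n))).isLt
  have h3 := invDescents_le (n + 1) σ n
  rw [rSeq_eq, Nat.add_sub_cancel]
  simp only [Fin.val_last] at h1
  omega

lemma monotone_unshift {n : ℕ} (σ : Equiv.Perm (Fin (n + 1))) {g : Fin (n + 1) → ℕ}
    (hg : StrictMono g) :
    Monotone fun i : Fin (n + 1) => g i + invDescents (n + 1) σ i - i := by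
  rw [Fin.monotone_iff_le_succ]
  intro i
  have h1 := hg i.castSucc_lt_succ
  have h2 := invDescents_succ (n + 1) σ i
  simp only [Fin.val_castSucc, Fin.val_succ]
  omega

lemma unshift_lt {n M : ℕ} (σ : Equiv.Perm (Fin (n + 1))) {g : Fin (n + 1) → ℕ}
    (hg : StrictMono g) (hlt : ∀ i, g i < n + 1 + M - rSeq (n + 1) σ) (i : Fin (n + 1)) :
    g i + invDescents (n + 1) σ i - i < M := by
  have h1 := monotone_unshift σ hg (Fin.le_last i)
  have h2 := hlt (Fin.last n)
  have h3 := invDescents_le (n + 1) σ n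
  have h4 := le_apply_of_strictMono hg (Fin.last n)
  rw [rSeq_eq, Nat.add_sub_cancel] at h2
  simp only [Fin.val_last] at h1 h4
  omega

/-- Words with sorting permutation `σ⁻¹` correspond to strictly increasing sequences. -/
def sortEquiv {n M : ℕ} (σ : Equiv.Perm (Fin (n + 1))) :
    {w : Fin (n + 1) → Fin M // Tuple.sort w = σ⁻¹} ≃
      (Fin (n + 1) ↪o Fin (n + 1 + M - rSeq (n + 1) σ)) where
  toFun w := OrderEmbedding.ofStrictMono
    (fun i => ⟨w.1 (σ⁻¹ i) + i - invDescents (n + 1) σ i, sorted_shift_lt σ w.2 i⟩)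
    (fun _ _ hij => strictMono_sorted_shift σ w.2 hij)
  invFun g := ⟨fun x => ⟨g (σ x) + invDescents (n + 1) σ (σ x) - (σ x),
      unshift_lt σ (g := fun i => g i) (fun _ _ hij => g.strictMono hij) (fun i => (g i).isLt) _⟩,
    by
    rw [sort_eq_iff_invDescents]
    intro i
    have h1 : (g i.castSucc : ℕ) < g i.succ := g.strictMono i.castSucc_lt_succ
    have h2 : ((i.castSucc : Fin (n + 1)) : ℕ) ≤ g i.castSucc :=
      le_apply_of_strictMono (g := fun i => (g i : ℕ)) (fun _ _ hij => g.strictMono hij) i.castSucc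
    simp only [Equiv.Perm.coe_inv, Equiv.apply_symm_apply, Fin.val_castSucc, Fin.val_succ] at h2 ⊢
    omega⟩
  left_inv w := by
    ext x
    have := invDescents_le (n + 1) σ (σ x)
    simp only [OrderEmbedding.coe_ofStrictMono, Equiv.Perm.coe_inv, Equiv.symm_apply_apply]
    omega
  right_inv g := by
    ext i
    have h2 : (i : ℕ) ≤ g i :=
      le_apply_of_strictMono (g := fun i => (g i : ℕ)) (fun _ _ hij => g.strictMono hij) i
    simp only [OrderEmbedding.coe_ofStrictMono, Equiv.Perm.coe_inv, Equiv.apply_symm_apply]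
    omega

lemma sortCount_inv (n M : ℕ) (σ : Equiv.Perm (Fin n)) :
    sortCount n M σ⁻¹ = (n + M - rSeq n σ).choose n := by
  cases n with
  | zero =>
    rw [sortCount, Finset.filter_true_of_mem fun w _ => Subsingleton.elim _ _]
    simp
  | succ n =>
    rw [← card_orderEmb_fin, ← Nat.card_congr (sortEquiv σ), Nat.card_eq_fintype_card,
      Fintype.card_subtype, sortCount]

lemma Qs_eq_sortCount (n M : ℕ) (σ : Equiv.Perm (Fin n)) :
    Qs n M σ = ((M : ℝ) ^ n)⁻¹ * sortCount n M σ⁻¹ := by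
  rw [Qs, sortCount_inv]

lemma Qs_nonneg (n M : ℕ) (σ : Equiv.Perm (Fin n)) : 0 ≤ Qs n M σ := by
  unfold Qs; positivity

lemma sum_sortCount_inv (n M : ℕ) : ∑ σ : Equiv.Perm (Fin n), sortCount n M σ⁻¹ = M ^ n := by
  rw [(Fintype.sum_equiv (Equiv.inv (Equiv.Perm (Fin n))) _ (sortCount n M) fun _ => rfl :
    ∑ σ : Equiv.Perm (Fin n), sortCount n M σ⁻¹ = ∑ π, sortCount n M π)]
  unfold sortCount
  rw [← Finset.card_eq_sum_card_fiberwise (fun _ _ => Finset.mem_coe.2 (Finset.mem_univ _))]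
  simp

lemma sum_Qs (n : ℕ) {M : ℕ} (hM : M ≠ 0) : ∑ σ : Equiv.Perm (Fin n), Qs n M σ = 1 := by
  simp_rw [Qs_eq_sortCount]
  rw [← Finset.mul_sum, ← Nat.cast_sum, sum_sortCount_inv, Nat.cast_pow]
  exact inv_mul_cancel₀ (pow_ne_zero _ (Nat.cast_ne_zero.2 hM))

/-- Stable sorting by a pair of letters amounts to two successive stable sortings. -/
lemma sort_finProdFinEquiv {n a b : ℕ} (u : Fin n → Fin a) (v : Fin n → Fin b) :
    Tuple.sort (fun x => finProdFinEquiv (u x, v x)) =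
      Tuple.sort v * Tuple.sort (u ∘ Tuple.sort v) := by
  have h1 := (Tuple.eq_sort_iff (f := v)).1 rfl
  have h2 := (Tuple.eq_sort_iff (f := u ∘ Tuple.sort v)).1 rfl
  set τ := Tuple.sort v
  set ρ := Tuple.sort (u ∘ τ)
  have hlex : ∀ i j, i < j → u (τ (ρ i)) < u (τ (ρ j)) ∨ u (τ (ρ i)) = u (τ (ρ j)) ∧
      (v (τ (ρ i)) < v (τ (ρ j)) ∨ v (τ (ρ i)) = v (τ (ρ j)) ∧ τ (ρ i) < τ (ρ j)) := by
    intro i j hij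
    rcases (h2.1 hij.le).lt_or_eq with h | h
    · exact Or.inl h
    · have hρ := h2.2 i j hij h
      refine Or.inr ⟨h, ?_⟩
      rcases (h1.1 hρ.le).lt_or_eq with h' | h'
      · exact Or.inl h'
      · exact Or.inr ⟨h', h1.2 _ _ hρ h'⟩
  symm
  rw [Tuple.eq_sort_iff]
  constructor
  · refine monotone_iff_forall_lt.2 fun i j hij => ?_
    simp only [Function.comp_apply, Equiv.Perm.mul_apply, Fin.le_def, finProdFinEquiv_apply_val]
    rcases hlex i j hij with h | ⟨h, h'⟩
    · have := Nat.mul_le_mul_left b (Nat.succ_le_of_lt (Fin.lt_def.1 h))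
      have := (v (τ (ρ i))).isLt
      rw [Nat.mul_succ] at *
      omega
    · rw [h]
      rcases h' with h' | h'
      · exact Nat.add_le_add_right (Fin.le_def.1 h'.le) _
      · exact Nat.add_le_add_right (Fin.le_def.1 h'.1.le) _
  · intro i j hij heq
    simp only [Equiv.Perm.mul_apply, EmbeddingLike.apply_eq_iff_eq, Prod.mk.injEq] at heq ⊢
    rcases hlex i j hij with h | ⟨-, h | h⟩
    · exact absurd heq.1 h.ne
    · exact absurd heq.2 h.ne
    · exact h.2

lemma sortCount_eq_sum (n M : ℕ) (π : Equiv.Perm (Fin n)) :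
    sortCount n M π = ∑ w : Fin n → Fin M, if Tuple.sort w = π then 1 else 0 := by
  rw [sortCount, Finset.card_filter]

lemma sortCount_mul (n a b : ℕ) (π : Equiv.Perm (Fin n)) :
    sortCount n (a * b) π =
      ∑ τ : Equiv.Perm (Fin n), sortCount n a (τ⁻¹ * π) * sortCount n b τ := by
  let e : (Fin n → Fin a) × (Fin n → Fin b) ≃ (Fin n → Fin (a * b)) :=
    (Equiv.arrowProdEquivProdArrow (Fin n) (fun _ => Fin a) (fun _ => Fin b)).symm.trans
      (Equiv.arrowCongr (Equiv.refl _) finProdFinEquiv)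
  have hsort : ∀ u v, Tuple.sort (e (u, v)) = Tuple.sort v * Tuple.sort (u ∘ Tuple.sort v) :=
    sort_finProdFinEquiv
  calc sortCount n (a * b) π
      = ∑ v : Fin n → Fin b, ∑ u : Fin n → Fin a,
          if Tuple.sort v * Tuple.sort (u ∘ Tuple.sort v) = π then 1 else 0 := by
        rw [sortCount_eq_sum, ← e.sum_comp, Fintype.sum_prod_type_right]
        simp_rw [hsort]
    _ = ∑ v : Fin n → Fin b, sortCount n a ((Tuple.sort v)⁻¹ * π) := by
        refine Finset.sum_congr rfl fun v _ => ?_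
        rw [sortCount_eq_sum]
        refine Fintype.sum_equiv (Equiv.arrowCongr (Tuple.sort v).symm (Equiv.refl (Fin a))) _ _
          fun u => if_congr ?_ rfl rfl
        rw [eq_inv_mul_iff_mul_eq]
        rfl
    _ = _ := by
        rw [← Finset.sum_fiberwise _ Tuple.sort]
        refine Finset.sum_congr rfl fun τ _ => ?_
        rw [Finset.sum_congr rfl fun v hv => by rw [(Finset.mem_filter.1 hv).2]]
        rw [Finset.sum_const, smul_eq_mul, mul_comm]
        rfl

/-- Two successive shuffles amount to a single one. -/
lemma convol_Qs (n a b : ℕ) : convol n (Qs n a) (Qs n b) = Qs n (a * b) := by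
  funext σ
  simp only [convol, Qs_eq_sortCount]
  have h := sortCount_mul n a b σ⁻¹
  rw [← Fintype.sum_equiv (Equiv.inv (Equiv.Perm (Fin n)))
    (fun τ => sortCount n a (τ * σ⁻¹) * sortCount n b τ⁻¹) _ (fun τ => by simp)] at h
  rw [h, Nat.cast_sum, Finset.mul_sum]
  refine Finset.sum_congr rfl fun τ _ => ?_
  simp only [mul_inv_rev, inv_inv]
  push_cast
  rw [mul_pow, mul_inv]
  ring

lemma Qs_one (n : ℕ) (σ : Equiv.Perm (Fin n)) : Qs n 1 σ = if σ = 1 then 1 else 0 := by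
  have h : ∀ w : Fin n → Fin 1, Tuple.sort w = 1 := fun w => by
    rw [eq_comm, Tuple.eq_sort_iff]
    exact ⟨fun i j _ => (Subsingleton.elim _ _).le, fun i j h _ => h⟩
  rw [Qs_eq_sortCount, sortCount]
  simp only [h, eq_comm (a := (1 : Equiv.Perm (Fin n))), inv_eq_one]
  split_ifs with hσ <;> simp [hσ]

lemma iterConv_Qs (n m k : ℕ) : iterConv n (Qs n m) k = Qs n (m ^ k) := by
  induction k with
  | zero => funext σ; rw [iterConv, pow_zero, Qs_one]
  | succ k ih => rw [iterConv, ih, convol_Qs, pow_succ']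
/-- The weight of `k` under the Poisson distribution of parameter `t`. -/
def pois (t : ℝ) (k : ℕ) : ℝ := Real.exp (-t) * (t ^ k / (k.factorial : ℝ))

/-- The Poisson probability of a set of natural numbers. -/
def poisP (t : ℝ) (S : Set ℕ) : ℝ := ∑' k, S.indicator (pois t) k

lemma pois_nonneg {t : ℝ} (ht : 0 ≤ t) (k : ℕ) : 0 ≤ pois t k := by
  unfold pois; positivity

lemma hasSum_pois_mul_pow (t x : ℝ) :
    HasSum (fun k => pois t k * x ^ k) (Real.exp (t * (x - 1))) := by
  have h : HasSum (fun k : ℕ => (t * x) ^ k / (k.factorial : ℝ)) (Real.exp (t * x)) := by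
    rw [Real.exp_eq_exp_ℝ]
    exact NormedSpace.expSeries_div_hasSum_exp (t * x)
  have h2 := h.mul_left (Real.exp (-t))
  rw [← Real.exp_add] at h2
  have h3 : (fun k => pois t k * x ^ k) =
      fun k => Real.exp (-t) * ((t * x) ^ k / (k.factorial : ℝ)) := by
    funext k
    rw [pois, mul_pow]
    ring
  rw [h3, show t * (x - 1) = -t + t * x by ring]
  exact h2

lemma hasSum_pois (t : ℝ) : HasSum (pois t) 1 := by
  simpa using hasSum_pois_mul_pow t 1

lemma summable_indicator_pois (t : ℝ) (S : Set ℕ) : Summable (S.indicator (pois t)) :=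
  (hasSum_pois t).summable.indicator S

lemma poisP_univ (t : ℝ) : poisP t Set.univ = 1 := by
  rw [poisP, Set.indicator_univ, (hasSum_pois t).tsum_eq]

lemma poisP_mono {t : ℝ} (ht : 0 ≤ t) {S R : Set ℕ} (h : S ⊆ R) : poisP t S ≤ poisP t R :=
  (summable_indicator_pois t S).tsum_le_tsum
    (fun k => Set.indicator_le_indicator_of_subset h (fun k => pois_nonneg ht k) k)
    (summable_indicator_pois t R)

lemma poisP_union_le {t : ℝ} (ht : 0 ≤ t) (S R : Set ℕ) :
    poisP t (S ∪ R) ≤ poisP t S + poisP t R := by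
  unfold poisP
  rw [← (summable_indicator_pois t S).tsum_add (summable_indicator_pois t R)]
  refine (summable_indicator_pois t _).tsum_le_tsum (fun k => ?_)
    ((summable_indicator_pois t S).add (summable_indicator_pois t R))
  have := pois_nonneg ht k
  by_cases h1 : k ∈ S <;> by_cases h2 : k ∈ R <;> simp [h1, h2, this]

lemma poisP_compl (t : ℝ) (S : Set ℕ) : poisP t Sᶜ = 1 - poisP t S := by
  rw [eq_sub_iff_add_eq, poisP, poisP,
    ← (summable_indicator_pois t _).tsum_add (summable_indicator_pois t S),
    ← (hasSum_pois t).tsum_eq]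
  exact tsum_congr fun k => congrFun (Set.indicator_compl_add_self S (pois t)) k

/-- Chernoff's bound. -/
lemma poisP_le_exp {t : ℝ} (ht : 0 ≤ t) {S : Set ℕ} {a θ : ℝ} (h : ∀ k ∈ S, a ≤ θ * k) :
    poisP t S ≤ Real.exp (t * (Real.exp θ - 1) - a) := by
  have h1 := (hasSum_pois_mul_pow t (Real.exp θ)).mul_right (Real.exp (-a))
  rw [← Real.exp_add, ← sub_eq_add_neg] at h1
  rw [← h1.tsum_eq]
  refine (summable_indicator_pois t S).tsum_le_tsum (fun k => ?_) h1.summable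
  have h0 := pois_nonneg ht k
  by_cases hk : k ∈ S
  · rw [Set.indicator_of_mem hk, mul_assoc, ← Real.exp_nat_mul, ← Real.exp_add]
    refine le_mul_of_one_le_right h0 (Real.one_le_exp ?_)
    linarith [h k hk, mul_comm θ (k : ℝ)]
  · rw [Set.indicator_of_notMem hk]
    positivity

lemma poisP_lower_tail {t T l : ℝ} (hT : 1 ≤ T) (ht : T ≤ t) :
    poisP t {k | (k : ℝ) ≤ T - l * √T} ≤ Real.exp (1 - l) := by
  have hs : 1 ≤ √T := Real.one_le_sqrt.2 hT
  have hs0 : 0 < √T := by linarith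
  have hsq : √T * √T = T := Real.mul_self_sqrt (by linarith)
  have hi : (√T)⁻¹ ≤ 1 := inv_le_one_of_one_le₀ hs
  have hi0 : 0 < (√T)⁻¹ := inv_pos.2 hs0
  refine (poisP_le_exp (a := l - √T) (θ := -(√T)⁻¹) (by linarith) fun k hk => ?_).trans ?_
  · have hk' : (k : ℝ) ≤ T - l * √T := hk
    have : (√T)⁻¹ * k ≤ (√T)⁻¹ * (T - l * √T) := mul_le_mul_of_nonneg_left hk' hi0.le
    have h2 : (√T)⁻¹ * (T - l * √T) = √T - l := by
      field_simp
      linarith [Real.sq_sqrt (show 0 ≤ T by linarith)]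
    linarith
  · apply Real.exp_le_exp.2
    have h1 := Real.abs_exp_sub_one_sub_id_le (x := -(√T)⁻¹)
      (by rw [abs_neg, abs_of_pos hi0]; exact hi)
    have h2 := (abs_le.1 h1).2
    have h3 : Real.exp (-(√T)⁻¹) - 1 ≤ -(√T)⁻¹ + (√T)⁻¹ ^ 2 := by linarith [neg_sq (√T)⁻¹]
    have h4 : -(√T)⁻¹ + (√T)⁻¹ ^ 2 ≤ 0 := by nlinarith
    have h5 : t * (Real.exp (-(√T)⁻¹) - 1) ≤ T * (-(√T)⁻¹ + (√T)⁻¹ ^ 2) := by nlinarith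
    have h6 : T * (-(√T)⁻¹ + (√T)⁻¹ ^ 2) = -√T + 1 := by
      have h7 : T = √T ^ 2 := by rw [sq, hsq]
      conv_lhs => rw [h7, Real.sqrt_sq hs0.le]
      field_simp
    linarith

lemma poisP_upper_tail {t T l : ℝ} (hT : 1 ≤ T) (ht0 : 0 ≤ t) (ht : t ≤ T) :
    poisP t {k | T + l * √T ≤ (k : ℝ)} ≤ Real.exp (1 - l) := by
  have hs : 1 ≤ √T := Real.one_le_sqrt.2 hT
  have hs0 : 0 < √T := by linarith
  have hsq : √T * √T = T := Real.mul_self_sqrt (by linarith)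
  have hi : (√T)⁻¹ ≤ 1 := inv_le_one_of_one_le₀ hs
  have hi0 : 0 < (√T)⁻¹ := inv_pos.2 hs0
  refine (poisP_le_exp (a := l + √T) (θ := (√T)⁻¹) ht0 fun k hk => ?_).trans ?_
  · have hk' : T + l * √T ≤ (k : ℝ) := hk
    have : (√T)⁻¹ * (T + l * √T) ≤ (√T)⁻¹ * k := mul_le_mul_of_nonneg_left hk' hi0.le
    have h2 : (√T)⁻¹ * (T + l * √T) = √T + l := by
      field_simp
      linarith [Real.sq_sqrt (show 0 ≤ T by linarith)]
    linarith
  · apply Real.exp_le_exp.2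
    have h1 := Real.abs_exp_sub_one_sub_id_le (x := (√T)⁻¹) (by rw [abs_of_pos hi0]; exact hi)
    have h2 := (abs_le.1 h1).2
    have h3 : Real.exp ((√T)⁻¹) - 1 ≤ (√T)⁻¹ + (√T)⁻¹ ^ 2 := by linarith
    have h5 : t * (Real.exp ((√T)⁻¹) - 1) ≤ T * ((√T)⁻¹ + (√T)⁻¹ ^ 2) := by
      have : 0 ≤ (√T)⁻¹ + (√T)⁻¹ ^ 2 := by positivity
      nlinarith
    have h6 : T * ((√T)⁻¹ + (√T)⁻¹ ^ 2) = √T + 1 := by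
      have h7 : T = √T ^ 2 := by rw [sq, hsq]
      conv_lhs => rw [h7, Real.sqrt_sq hs0.le]
      field_simp
    linarith

lemma half_le_poisP_window {s : ℝ} (hs : 1 ≤ s) :
    1 / 2 ≤ poisP s {k | |(k : ℝ) - s| < 4 * √s} := by
  have h1 := poisP_lower_tail (l := 4) hs le_rfl
  have h2 := poisP_upper_tail (l := 4) hs (by linarith) le_rfl
  have h3 := poisP_union_le (by linarith : (0 : ℝ) ≤ s)
    {k | (k : ℝ) ≤ s - 4 * √s} {k | s + 4 * √s ≤ (k : ℝ)}
  have h4 : ({k | |(k : ℝ) - s| < 4 * √s}ᶜ : Set ℕ) ⊆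
      {k | (k : ℝ) ≤ s - 4 * √s} ∪ {k | s + 4 * √s ≤ (k : ℝ)} := by
    intro k hk
    have hk' : 4 * √s ≤ |(k : ℝ) - s| := not_lt.1 hk
    rcases le_abs.1 hk' with h | h
    · exact Or.inr (show s + 4 * √s ≤ (k : ℝ) by linarith)
    · exact Or.inl (show (k : ℝ) ≤ s - 4 * √s by linarith)
  have h5 := poisP_mono (by linarith : (0 : ℝ) ≤ s) h4
  rw [poisP_compl] at h5
  have h6 : Real.exp (1 - 4) ≤ 1 / 4 := by
    rw [show (1 - 4 : ℝ) = -3 by norm_num, Real.exp_neg, one_div]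
    exact inv_anti₀ (by norm_num) (by linarith [Real.add_one_le_exp (3 : ℝ)])
  have h7 := h5.trans (h3.trans (add_le_add (h1.trans h6) (h2.trans h6)))
  linarith

lemma pois_mul_exp_le {s t : ℝ} (hs : 0 < s) (ht : 0 < t) (k : ℕ) :
    pois s k * Real.exp ((t - s) * (k - t) / t) ≤ pois t k := by
  have h1 : Real.log (s / t) ≤ s / t - 1 := Real.log_le_sub_one_of_pos (by positivity)
  have h2 : s ^ k = t ^ k * Real.exp (k * Real.log (s / t)) := by
    rw [Real.exp_nat_mul, Real.exp_log (by positivity), ← mul_pow, mul_div_cancel₀ _ ht.ne']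
  have h3 : pois s k * Real.exp ((t - s) * (k - t) / t) =
      pois t k * Real.exp (k * (Real.log (s / t) - (s / t - 1))) := by
    have : Real.exp (-s) * Real.exp (k * Real.log (s / t)) * Real.exp ((t - s) * (k - t) / t) =
        Real.exp (-t) * Real.exp (k * (Real.log (s / t) - (s / t - 1))) := by
      rw [← Real.exp_add, ← Real.exp_add, ← Real.exp_add]
      congr 1
      field_simp
      ring
    unfold pois
    rw [h2]
    linear_combination (t ^ k / (k.factorial : ℝ)) * this
  rw [h3]
  refine mul_le_of_le_one_right (pois_nonneg ht.le k) (Real.exp_le_one_iff.2 ?_)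
  exact mul_nonpos_of_nonneg_of_nonpos (by positivity) (by linarith)

lemma exp_le_poisP {s t κ : ℝ} (hs : 1 ≤ s) (ht : 0 < t) {S : Set ℕ}
    (h : ∀ k : ℕ, |(k : ℝ) - s| < 4 * √s → k ∈ S ∧ -κ ≤ (t - s) * (k - t) / t) :
    Real.exp (-κ) / 2 ≤ poisP t S := by
  have h1 := mul_le_mul_of_nonneg_right (half_le_poisP_window hs) (Real.exp_pos (-κ)).le
  rw [poisP, ← tsum_mul_right] at h1
  refine le_trans (by linarith) (h1.trans ?_)
  refine ((summable_indicator_pois s _).mul_right _).tsum_le_tsum (fun k => ?_)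
    (summable_indicator_pois t S)
  by_cases hk : |(k : ℝ) - s| < 4 * √s
  · rw [Set.indicator_of_mem (show k ∈ {k : ℕ | |(k : ℝ) - s| < 4 * √s} from hk),
      Set.indicator_of_mem (h k hk).1]
    refine le_trans ?_ (pois_mul_exp_le (zero_lt_one.trans_le hs) ht k)
    exact mul_le_mul_of_nonneg_left (Real.exp_le_exp.2 (h k hk).2)
      (pois_nonneg (zero_le_one.trans hs) k)
  · rw [Set.indicator_of_notMem (show k ∉ {k : ℕ | |(k : ℝ) - s| < 4 * √s} from hk), zero_mul]
    exact Set.indicator_nonneg (fun k _ => pois_nonneg ht.le k) _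
lemma sum_Us (n : ℕ) : ∑ σ : Equiv.Perm (Fin n), Us n σ = 1 := by
  simp only [Us, Finset.sum_const, Finset.card_univ, Fintype.card_perm, Fintype.card_fin,
    nsmul_eq_mul]
  exact mul_inv_cancel₀ (by positivity)

lemma Us_pos (n : ℕ) (σ : Equiv.Perm (Fin n)) : 0 < Us n σ := by
  unfold Us; positivity

lemma tv_nonneg (n : ℕ) (μ ν : Equiv.Perm (Fin n) → ℝ) : 0 ≤ tv n μ ν :=
  mul_nonneg (by norm_num) (Finset.sum_nonneg fun _ _ => abs_nonneg _)

lemma tv_le_one {n : ℕ} {μ ν : Equiv.Perm (Fin n) → ℝ} (hμ : ∀ σ, 0 ≤ μ σ) (hν : ∀ σ, 0 ≤ ν σ)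
    (hμ1 : ∑ σ, μ σ = 1) (hν1 : ∑ σ, ν σ = 1) : tv n μ ν ≤ 1 := by
  have h : ∑ σ, |μ σ - ν σ| ≤ ∑ σ, (μ σ + ν σ) := Finset.sum_le_sum fun σ _ => by
    rw [abs_le]; constructor <;> linarith [hμ σ, hν σ]
  rw [Finset.sum_add_distrib, hμ1, hν1] at h
  unfold tv
  linarith

lemma sub_le_tv {n : ℕ} {μ ν : Equiv.Perm (Fin n) → ℝ} (h : ∑ σ, μ σ = ∑ σ, ν σ)
    (A : Finset (Equiv.Perm (Fin n))) : ∑ σ ∈ A, μ σ - ∑ σ ∈ A, ν σ ≤ tv n μ ν := by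
  have h1 : ∑ σ ∈ A, (μ σ - ν σ) ≤ ∑ σ ∈ A, |μ σ - ν σ| :=
    Finset.sum_le_sum fun σ _ => le_abs_self _
  have h2 : -∑ σ ∈ Aᶜ, (μ σ - ν σ) ≤ ∑ σ ∈ Aᶜ, |μ σ - ν σ| := by
    rw [← Finset.sum_neg_distrib]
    exact Finset.sum_le_sum fun σ _ => neg_le_abs _
  have h3 := Finset.sum_add_sum_compl A fun σ => |μ σ - ν σ|
  have h4 := Finset.sum_add_sum_compl A fun σ => μ σ - ν σ
  rw [Finset.sum_sub_distrib (s := Finset.univ), h, sub_self] at h4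
  rw [← Finset.sum_sub_distrib]
  unfold tv
  linarith

lemma tv_Qs_le_one (n : ℕ) {M : ℕ} (hM : M ≠ 0) : tv n (Qs n M) (Us n) ≤ 1 :=
  tv_le_one (Qs_nonneg n M) (fun σ => (Us_pos n σ).le) (sum_Qs n hM) (sum_Us n)

section Mixture

variable {n m : ℕ}

lemma Qs_le_one (n : ℕ) {M : ℕ} (hM : M ≠ 0) (σ : Equiv.Perm (Fin n)) : Qs n M σ ≤ 1 := by
  rw [← sum_Qs n hM]
  exact Finset.single_le_sum (fun σ _ => Qs_nonneg n M σ) (Finset.mem_univ σ)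

lemma summable_pois_mul {t : ℝ} (ht : 0 ≤ t) {f : ℕ → ℝ} (h0 : ∀ k, 0 ≤ f k) (h1 : ∀ k, f k ≤ 1) :
    Summable fun k => pois t k * f k :=
  Summable.of_nonneg_of_le (fun k => mul_nonneg (pois_nonneg ht k) (h0 k))
    (fun k => mul_le_of_le_one_right (pois_nonneg ht k) (h1 k)) (hasSum_pois t).summable

lemma hasSum_Hm (hm : m ≠ 0) {t : ℝ} (ht : 0 ≤ t) (σ : Equiv.Perm (Fin n)) :
    HasSum (fun k => pois t k * Qs n (m ^ k) σ) (Hm n m t σ) := by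
  have h : Hm n m t σ = ∑' k, pois t k * Qs n (m ^ k) σ := by
    rw [Hm, ← tsum_mul_left]
    refine tsum_congr fun k => ?_
    rw [iterConv_Qs, pois, mul_assoc]
  rw [h]
  exact (summable_pois_mul ht (fun k => Qs_nonneg n _ σ)
    fun k => Qs_le_one n (pow_ne_zero k hm) σ).hasSum

lemma hasSum_sum_Hm (hm : m ≠ 0) {t : ℝ} (ht : 0 ≤ t) (A : Finset (Equiv.Perm (Fin n))) :
    HasSum (fun k => pois t k * ∑ σ ∈ A, Qs n (m ^ k) σ) (∑ σ ∈ A, Hm n m t σ) := by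
  simp_rw [Finset.mul_sum]
  exact hasSum_sum fun σ _ => hasSum_Hm hm ht σ

lemma Hm_nonneg (hm : m ≠ 0) {t : ℝ} (ht : 0 ≤ t) (σ : Equiv.Perm (Fin n)) : 0 ≤ Hm n m t σ :=
  (hasSum_Hm hm ht σ).nonneg fun k => mul_nonneg (pois_nonneg ht k) (Qs_nonneg n _ σ)

lemma sum_Hm (hm : m ≠ 0) {t : ℝ} (ht : 0 ≤ t) : ∑ σ : Equiv.Perm (Fin n), Hm n m t σ = 1 := by
  have h := hasSum_sum_Hm (n := n) hm ht Finset.univ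
  simp_rw [fun k => sum_Qs n (pow_ne_zero k hm), mul_one] at h
  exact h.unique (hasSum_pois t)

lemma tv_Hm_le_one (hm : m ≠ 0) {t : ℝ} (ht : 0 ≤ t) : tv n (Hm n m t) (Us n) ≤ 1 :=
  tv_le_one (Hm_nonneg hm ht) (fun σ => (Us_pos n σ).le) (sum_Hm hm ht) (sum_Us n)

lemma tv_Hm_le (hm : m ≠ 0) {t δ : ℝ} (ht : 0 ≤ t) (hδ : 0 ≤ δ) {S : Set ℕ}
    (h : ∀ k ∉ S, tv n (Qs n (m ^ k)) (Us n) ≤ δ) :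
    tv n (Hm n m t) (Us n) ≤ poisP t S + δ := by
  have h1 : Summable fun k => pois t k * tv n (Qs n (m ^ k)) (Us n) :=
    summable_pois_mul ht (fun k => tv_nonneg _ _ _) fun k => tv_Qs_le_one n (pow_ne_zero k hm)
  have hQ : ∀ σ, Summable fun k => pois t k * |Qs n (m ^ k) σ - Us n σ| := fun σ => by
    refine Summable.of_nonneg_of_le (fun k => mul_nonneg (pois_nonneg ht k) (abs_nonneg _))
      (fun k => mul_le_mul_of_nonneg_left ?_ (pois_nonneg ht k))
      ((hasSum_pois t).summable.mul_right (1 + Us n σ))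
    rw [abs_le]
    constructor <;> linarith [Qs_nonneg n (m ^ k) σ, Qs_le_one n (pow_ne_zero k hm) σ, Us_pos n σ]
  have h2 : ∀ σ, |Hm n m t σ - Us n σ| ≤ ∑' k, pois t k * |Qs n (m ^ k) σ - Us n σ| := fun σ => by
    have h3 := (hasSum_Hm hm ht σ).sub ((hasSum_pois t).mul_right (Us n σ))
    rw [one_mul] at h3
    rw [← h3.tsum_eq, ← Real.norm_eq_abs]
    refine tsum_of_norm_bounded (hQ σ).hasSum fun k => ?_
    rw [← mul_sub, norm_mul, Real.norm_eq_abs, Real.norm_eq_abs, abs_of_nonneg (pois_nonneg ht k)]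
  have h4 : tv n (Hm n m t) (Us n) ≤ ∑' k, pois t k * tv n (Qs n (m ^ k)) (Us n) := by
    have h5 : ∑' k, pois t k * tv n (Qs n (m ^ k)) (Us n) =
        (1 / 2) * ∑ σ, ∑' k, pois t k * |Qs n (m ^ k) σ - Us n σ| := by
      rw [← Summable.tsum_finsetSum fun σ _ => hQ σ, ← tsum_mul_left]
      refine tsum_congr fun k => ?_
      rw [tv, ← Finset.mul_sum]
      ring
    rw [h5, tv]
    exact mul_le_mul_of_nonneg_left (Finset.sum_le_sum fun σ _ => h2 σ) (by norm_num)
  refine h4.trans ?_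
  have h6 := (summable_indicator_pois t S).add ((hasSum_pois t).summable.mul_right δ)
  refine (h1.tsum_le_tsum (fun k => ?_) h6).trans ?_
  · have hp := pois_nonneg ht k
    by_cases hk : k ∈ S
    · rw [Set.indicator_of_mem hk]
      have := mul_le_of_le_one_right hp (tv_Qs_le_one n (pow_ne_zero k hm))
      nlinarith
    · rw [Set.indicator_of_notMem hk, zero_add]
      exact mul_le_mul_of_nonneg_left (h k hk) hp
  · rw [(summable_indicator_pois t S).tsum_add ((hasSum_pois t).summable.mul_right δ),
      tsum_mul_right,
      (hasSum_pois t).tsum_eq, one_mul, poisP]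

lemma le_tv_Hm (hm : m ≠ 0) {t δ : ℝ} (ht : 0 ≤ t) {S : Set ℕ} (A : Finset (Equiv.Perm (Fin n)))
    (h : ∀ k ∈ S, 1 - δ ≤ ∑ σ ∈ A, Qs n (m ^ k) σ) :
    poisP t S * (1 - δ) - ∑ σ ∈ A, Us n σ ≤ tv n (Hm n m t) (Us n) := by
  refine le_trans ?_ (sub_le_tv ((sum_Hm hm ht).trans (sum_Us n).symm) A)
  refine sub_le_sub_right ?_ _
  rw [poisP, ← tsum_mul_right, ← (hasSum_sum_Hm hm ht A).tsum_eq]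
  refine ((summable_indicator_pois t S).mul_right _).tsum_le_tsum (fun k => ?_)
    (hasSum_sum_Hm hm ht A).summable
  have hp := pois_nonneg ht k
  by_cases hk : k ∈ S
  · rw [Set.indicator_of_mem hk]
    exact mul_le_mul_of_nonneg_left (h k hk) hp
  · rw [Set.indicator_of_notMem hk, zero_mul]
    exact mul_nonneg hp (Finset.sum_nonneg fun σ _ => Qs_nonneg n _ σ)

end Mixture
lemma Qs_eq_zero {n M : ℕ} {σ : Equiv.Perm (Fin (n + 1))} (h : M < rSeq (n + 1) σ) :
    Qs (n + 1) M σ = 0 := by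
  have := rSeq_le n σ
  rw [Qs, Nat.choose_eq_zero_of_lt (by omega), Nat.cast_zero, mul_zero]

lemma Qs_eq_prod {n M : ℕ} (hM : M ≠ 0) {σ : Equiv.Perm (Fin n)} (h : rSeq n σ ≤ M) :
    Qs n M σ = Us n σ * ∏ i ∈ Finset.range n, (1 + ((i : ℝ) + 1 - rSeq n σ) / M) := by
  have hM' : (M : ℝ) ≠ 0 := Nat.cast_ne_zero.2 hM
  have h1 : ∀ i ∈ Finset.range n, (1 + ((i : ℝ) + 1 - rSeq n σ) / M) =
      (M : ℝ)⁻¹ * ((M - rSeq n σ + 1 + i : ℕ) : ℝ) := fun i _ => by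
    push_cast [Nat.cast_sub h]
    field_simp
    ring
  have h2 := Nat.ascFactorial_eq_factorial_mul_choose (M - rSeq n σ) n
  rw [Nat.ascFactorial_eq_prod_range, show M - rSeq n σ + n = n + M - rSeq n σ by omega] at h2
  rw [Finset.prod_congr rfl h1, Finset.prod_mul_distrib, ← Nat.cast_prod, h2, Finset.prod_const,
    Finset.card_range, Qs, Us, inv_pow]
  push_cast
  field_simp

lemma sum_range_shift (n : ℕ) (r : ℝ) :
    ∑ i ∈ Finset.range n, ((i : ℝ) + 1 - r) = n * ((n + 1) / 2 - r) := by
  induction n with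
  | zero => simp
  | succ n ih => rw [Finset.sum_range_succ, ih]; push_cast; ring

lemma sub_two_mul_sq_le_log {x : ℝ} (hx : -(1 / 2) ≤ x) : x - 2 * x ^ 2 ≤ Real.log (1 + x) := by
  have h0 : 0 < 1 + x := by linarith
  refine le_trans ?_ (Real.one_sub_inv_le_log_of_pos h0)
  rw [show 1 - (1 + x)⁻¹ = x / (1 + x) by field_simp; ring, le_div_iff₀ h0]
  nlinarith [mul_nonneg (sq_nonneg x) (by linarith : 0 ≤ 1 + 2 * x)]

lemma log_one_sub_le {u : ℝ} (h0 : 0 ≤ u) (h1 : u < 1) :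
    Real.log (1 - u) ≤ -u - u ^ 2 / 2 := by
  have h := sum_le_hasSum (Finset.range 2) (fun i _ => by positivity)
    (Real.hasSum_pow_div_log_of_abs_lt_one (x := u) (by rwa [abs_of_nonneg h0]))
  norm_num [Finset.sum_range_succ] at h
  linarith

lemma le_Qs {n M : ℕ} (hM : M ≠ 0) (hnM : 2 * n ≤ M) (σ : Equiv.Perm (Fin n)) :
    Us n σ * Real.exp (n * ((n + 1) / 2 - rSeq n σ) / M - 2 * (n : ℝ) ^ 3 / (M : ℝ) ^ 2) ≤
      Qs n M σ := by
  have hM0 : (0 : ℝ) < M := Nat.cast_pos.2 (Nat.pos_of_ne_zero hM)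
  have hr1 := one_le_rSeq n σ
  have hr2 : n ≠ 0 → rSeq n σ ≤ n := by
    cases n with
    | zero => simp
    | succ n => exact fun _ => rSeq_le n σ
  have hr3 : rSeq n σ ≤ M := by
    rcases eq_or_ne n 0 with rfl | hn
    · simp [rSeq]; omega
    · have := hr2 hn; omega
  rw [Qs_eq_prod hM hr3]
  refine mul_le_mul_of_nonneg_left ?_ (Us_pos n σ).le
  have key : ∀ i ∈ Finset.range n, Real.exp (((i : ℝ) + 1 - rSeq n σ) / M -
      2 * (n : ℝ) ^ 2 / (M : ℝ) ^ 2) ≤ 1 + ((i : ℝ) + 1 - rSeq n σ) / M := fun i hi => by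
    have hi := Finset.mem_range.1 hi
    have hi' : (i : ℝ) + 1 ≤ n := by exact_mod_cast hi
    have hr1' : (1 : ℝ) ≤ rSeq n σ := by exact_mod_cast hr1
    have hr2' : (rSeq n σ : ℝ) ≤ n := by exact_mod_cast hr2 (by omega)
    have hnM' : 2 * (n : ℝ) ≤ M := by exact_mod_cast hnM
    have hi0 : (0 : ℝ) ≤ i := Nat.cast_nonneg i
    have hx : -(1 / 2) ≤ ((i : ℝ) + 1 - rSeq n σ) / M := by
      rw [le_div_iff₀ hM0]; linarith
    have hsq : (((i : ℝ) + 1 - rSeq n σ) / M) ^ 2 ≤ (n : ℝ) ^ 2 / (M : ℝ) ^ 2 := by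
      rw [div_pow]
      refine div_le_div_of_nonneg_right ?_ (by positivity)
      exact sq_le_sq' (by linarith) (by linarith)
    rw [← Real.le_log_iff_exp_le (by linarith)]
    refine le_trans ?_ (sub_two_mul_sq_le_log hx)
    rw [mul_div_assoc]
    linarith
  refine le_trans (le_of_eq ?_) (Finset.prod_le_prod (fun i _ => (Real.exp_pos _).le) key)
  rw [← Real.exp_sum, Finset.sum_sub_distrib, ← Finset.sum_div, sum_range_shift, Finset.sum_const,
    Finset.card_range, nsmul_eq_mul]
  congr 2
  ring

lemma Qs_le {n M : ℕ} (hM : M ≠ 0) {σ : Equiv.Perm (Fin n)} (hn : 8 ≤ n)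
    (hr : (n : ℝ) / 4 ≤ rSeq n σ) :
    Qs n M σ ≤ Us n σ *
      Real.exp (n * ((n + 1) / 2 - rSeq n σ) / M - (n : ℝ) ^ 3 / (2048 * (M : ℝ) ^ 2)) := by
  have hM0 : (0 : ℝ) < M := Nat.cast_pos.2 (Nat.pos_of_ne_zero hM)
  obtain ⟨n, rfl⟩ := Nat.exists_eq_succ_of_ne_zero (by omega : n ≠ 0)
  rcases lt_or_ge M (rSeq (n + 1) σ) with hlt | hrM
  · rw [Qs_eq_zero hlt]
    exact mul_nonneg (Us_pos _ σ).le (Real.exp_pos _).le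
  have hr2 := rSeq_le n σ
  rw [Qs_eq_prod hM hrM]
  refine mul_le_mul_of_nonneg_left ?_ (Us_pos _ σ).le
  set N := n + 1
  set r := rSeq N σ
  have hrM' : (r : ℝ) ≤ M := by exact_mod_cast hrM
  have key : ∀ i ∈ Finset.range N, 1 + ((i : ℝ) + 1 - r) / M ≤ Real.exp (((i : ℝ) + 1 - r) / M -
      if i < r / 2 then (r : ℝ) ^ 2 / (8 * (M : ℝ) ^ 2) else 0) := fun i hi => by
    split_ifs with h
    · have h' : (i : ℝ) + 1 ≤ r / 2 := by
        rw [le_div_iff₀ two_pos]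
        have : (i + 1) * 2 ≤ r := by omega
        exact_mod_cast this
      have hi0 : (0 : ℝ) ≤ i := Nat.cast_nonneg i
      have hu0 : (r : ℝ) / 2 / M ≤ (r - (i + 1)) / M :=
        div_le_div_of_nonneg_right (by linarith) hM0.le
      have hu1 : ((r : ℝ) - (i + 1)) / M < 1 := by
        rw [div_lt_one hM0]; linarith
      have hu2 : (0 : ℝ) ≤ r / 2 / M := by positivity
      have hlog := log_one_sub_le (hu2.trans hu0) hu1
      have hsq := pow_le_pow_left₀ hu2 hu0 2
      have e1 : ((i : ℝ) + 1 - r) / M = -((r - (i + 1)) / M) := by ring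
      have e2 : ((r : ℝ) / 2 / M) ^ 2 / 2 = (r : ℝ) ^ 2 / (8 * (M : ℝ) ^ 2) := by
        field_simp; norm_num
      rw [e1, ← sub_eq_add_neg, ← Real.log_le_iff_le_exp (by linarith)]
      linarith
    · rw [sub_zero, add_comm]
      exact Real.add_one_le_exp _
  have hpos : ∀ i ∈ Finset.range N, 0 ≤ 1 + ((i : ℝ) + 1 - r) / M := fun i _ => by
    have : (-1 : ℝ) ≤ ((i : ℝ) + 1 - r) / M := by
      rw [le_div_iff₀ hM0]
      linarith [(Nat.cast_nonneg i : (0 : ℝ) ≤ i)]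
    linarith
  refine (Finset.prod_le_prod hpos key).trans ?_
  rw [← Real.exp_sum, Finset.sum_sub_distrib, ← Finset.sum_div, sum_range_shift]
  refine Real.exp_le_exp.2 (sub_le_sub_left ?_ _)
  rw [← Finset.sum_filter, Finset.sum_const, nsmul_eq_mul]
  have hcard : ((Finset.range N).filter fun i => i < r / 2).card = r / 2 := by
    rw [show (Finset.range N).filter (fun i => i < r / 2) = Finset.range (r / 2) by
      ext i; simp only [Finset.mem_filter, Finset.mem_range]; omega, Finset.card_range]
  have hr4 : (r : ℝ) / 4 ≤ ((r / 2 : ℕ) : ℝ) := by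
    have h8 : (8 : ℝ) ≤ N := by exact_mod_cast hn
    have h2 : 2 ≤ r := by
      have : (2 : ℝ) ≤ r := by linarith
      exact_mod_cast this
    have : r ≤ 4 * (r / 2) := by omega
    have : (r : ℝ) ≤ 4 * ((r / 2 : ℕ) : ℝ) := by exact_mod_cast this
    linarith
  rw [hcard]
  have h3 : ((N : ℝ) / 4) ^ 3 ≤ (r : ℝ) ^ 3 := pow_le_pow_left₀ (by positivity) hr 3
  calc (N : ℝ) ^ 3 / (2048 * (M : ℝ) ^ 2) = ((N : ℝ) / 4) ^ 3 / (32 * (M : ℝ) ^ 2) := by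
        field_simp; ring
    _ ≤ (r : ℝ) ^ 3 / (32 * (M : ℝ) ^ 2) := div_le_div_of_nonneg_right h3 (by positivity)
    _ = (r : ℝ) / 4 * ((r : ℝ) ^ 2 / (8 * (M : ℝ) ^ 2)) := by field_simp; ring
    _ ≤ _ := mul_le_mul_of_nonneg_right hr4 (by positivity)

lemma invAt_mul_revPerm {n i : ℕ} (σ : Equiv.Perm (Fin n)) (hi : i < n) :
    invAt n (σ * Fin.revPerm) i = n - 1 - invAt n σ i := by
  unfold invAt
  rw [dif_pos hi, dif_pos hi, mul_inv_rev, Equiv.Perm.mul_apply]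
  change ((Fin.rev (σ⁻¹ ⟨i, hi⟩) : Fin n) : ℕ) = _
  rw [Fin.val_rev]
  omega

lemma rSeq_mul_revPerm {n : ℕ} (hn : n ≠ 0) (σ : Equiv.Perm (Fin n)) :
    rSeq n (σ * Fin.revPerm) + rSeq n σ = n + 1 := by
  have h : (Finset.range (n - 1)).filter (fun i => invAt n (σ * Fin.revPerm) (i + 1) <
      invAt n (σ * Fin.revPerm) i) =
      (Finset.range (n - 1)).filter fun i => ¬ invAt n σ (i + 1) < invAt n σ i := by
    refine Finset.filter_congr fun i hi => ?_
    rw [Finset.mem_range] at hi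
    rw [invAt_mul_revPerm σ (by omega), invAt_mul_revPerm σ (by omega)]
    have h1 : invAt n σ i ≠ invAt n σ (i + 1) := by
      unfold invAt
      rw [dif_pos (by omega), dif_pos (by omega), Ne, Fin.val_inj, EmbeddingLike.apply_eq_iff_eq]
      simp
    have h2 : ∀ j, j < n → invAt n σ j < n := fun j hj => by
      unfold invAt
      rw [dif_pos hj]
      exact Fin.isLt _
    have := h2 i (by omega)
    have := h2 (i + 1) (by omega)
    omega
  have h2 := Finset.card_filter_add_card_filter_not (s := Finset.range (n - 1))
    (fun i => invAt n σ (i + 1) < invAt n σ i)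
  rw [Finset.card_range] at h2
  rw [rSeq, rSeq, h]
  omega

lemma sum_Us_mul_rSeq {n : ℕ} (hn : n ≠ 0) :
    ∑ σ : Equiv.Perm (Fin n), Us n σ * (((n : ℝ) + 1) / 2 - rSeq n σ) = 0 := by
  have h := Fintype.sum_equiv (Equiv.mulRight (Fin.revPerm : Equiv.Perm (Fin n)))
    (fun σ => Us n σ * (((n : ℝ) + 1) / 2 - rSeq n (σ * Fin.revPerm)))
    (fun σ => Us n σ * (((n : ℝ) + 1) / 2 - rSeq n σ)) fun σ => by
      simp only [Equiv.coe_mulRight, Us]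
  have h2 : ∀ σ : Equiv.Perm (Fin n), Us n σ * (((n : ℝ) + 1) / 2 - rSeq n (σ * Fin.revPerm)) =
      -(Us n σ * (((n : ℝ) + 1) / 2 - rSeq n σ)) := fun σ => by
    have : (rSeq n (σ * Fin.revPerm) : ℝ) + rSeq n σ = n + 1 := by
      exact_mod_cast rSeq_mul_revPerm hn σ
    rw [show (rSeq n (σ * Fin.revPerm) : ℝ) = n + 1 - rSeq n σ by linarith]
    ring
  rw [Finset.sum_congr rfl fun σ _ => h2 σ, Finset.sum_neg_distrib] at h
  linarith

/-- A form of Pinsker's inequality for the relative entropy with respect to `μ`. -/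
lemma tv_sq_le {n : ℕ} {μ : Equiv.Perm (Fin n) → ℝ} {g : Equiv.Perm (Fin n) → ℝ} {κ : ℝ}
    (hμ1 : ∑ σ, μ σ = 1)
    (hg : ∀ σ, Us n σ * Real.exp (g σ) ≤ μ σ) (hκ : -κ ≤ ∑ σ, Us n σ * g σ) :
    tv n μ (Us n) ^ 2 ≤ κ := by
  have hμ : ∀ σ, 0 ≤ μ σ := fun σ => (mul_nonneg (Us_pos n σ).le (Real.exp_pos _).le).trans (hg σ)
  have hU : ∀ σ, 0 ≤ Us n σ := fun σ => (Us_pos n σ).le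
  have h1 : 1 - κ / 2 ≤ ∑ σ, √(μ σ) * √(Us n σ) := by
    calc 1 - κ / 2 ≤ ∑ σ, Us n σ * (1 + g σ / 2) := by
          have : ∑ σ, Us n σ * (1 + g σ / 2) = ∑ σ, Us n σ + (∑ σ, Us n σ * g σ) / 2 := by
            rw [Finset.sum_div, ← Finset.sum_add_distrib]
            exact Finset.sum_congr rfl fun σ _ => by ring
          rw [this, sum_Us]
          linarith
      _ ≤ _ := Finset.sum_le_sum fun σ _ => by
          rw [← Real.sqrt_mul (hμ σ)]
          refine Real.le_sqrt_of_sq_le ?_ |>.trans' (b := Us n σ * Real.exp (g σ / 2)) ?_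
          · refine le_trans (le_of_eq ?_) (mul_le_mul_of_nonneg_right (hg σ) (hU σ))
            rw [mul_pow, ← Real.exp_nat_mul]
            push_cast
            rw [mul_div_cancel₀ _ (two_ne_zero)]
            ring
          · refine mul_le_mul_of_nonneg_left ?_ (hU σ)
            linarith [Real.add_one_le_exp (g σ / 2)]
  have hs : ∀ σ, √(μ σ) ^ 2 = μ σ := fun σ => Real.sq_sqrt (hμ σ)
  have hs' : ∀ σ, √(Us n σ) ^ 2 = Us n σ := fun σ => Real.sq_sqrt (hU σ)
  have h2 : ∑ σ, (√(μ σ) - √(Us n σ)) ^ 2 = 2 - 2 * ∑ σ, √(μ σ) * √(Us n σ) := by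
    calc _ = ∑ σ, (μ σ + Us n σ - 2 * (√(μ σ) * √(Us n σ))) :=
          Finset.sum_congr rfl fun σ _ => by rw [sub_sq, hs, hs']; ring
      _ = _ := by
          rw [Finset.sum_sub_distrib, Finset.sum_add_distrib, hμ1, sum_Us, ← Finset.mul_sum]
          norm_num
  have h3 : ∑ σ, (√(μ σ) + √(Us n σ)) ^ 2 ≤ 4 := by
    calc _ ≤ ∑ σ, 2 * (μ σ + Us n σ) := Finset.sum_le_sum fun σ _ => by
          linarith [sq_nonneg (√(μ σ) - √(Us n σ)), add_sq (√(μ σ)) (√(Us n σ)),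
            sub_sq (√(μ σ)) (√(Us n σ)), hs σ, hs' σ]
      _ = _ := by
          rw [← Finset.mul_sum, Finset.sum_add_distrib, hμ1, sum_Us]; norm_num
  have h4 := Finset.sum_mul_sq_le_sq_mul_sq Finset.univ
    (fun σ => |√(μ σ) - √(Us n σ)|) (fun σ => √(μ σ) + √(Us n σ))
  have h5 : ∀ σ, |√(μ σ) - √(Us n σ)| * (√(μ σ) + √(Us n σ)) = |μ σ - Us n σ| := fun σ => by
    rw [← abs_of_nonneg (add_nonneg (Real.sqrt_nonneg (μ σ)) (Real.sqrt_nonneg (Us n σ))),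
      ← abs_mul]
    congr 1
    linear_combination hs σ - hs' σ
  simp only [h5, sq_abs] at h4
  rw [h2] at h4
  have h6 : 0 ≤ 2 - 2 * ∑ σ, √(μ σ) * √(Us n σ) := by
    rw [← h2]; exact Finset.sum_nonneg fun σ _ => sq_nonneg _
  have h7 := mul_le_mul_of_nonneg_left h3 h6
  rw [tv, mul_pow]
  linarith

lemma tv_Qs_le {n M : ℕ} {L : ℝ} (hn : n ≠ 0) (hL : 2 ≤ L) (hM : L * (n * √n) ≤ M) :
    tv n (Qs n M) (Us n) ≤ 2 / L := by
  have hn1 : (1 : ℝ) ≤ n := by exact_mod_cast Nat.one_le_iff_ne_zero.2 hn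
  have hs1 : 1 ≤ √(n : ℝ) := Real.one_le_sqrt.2 hn1
  have hs : √(n : ℝ) ^ 2 = n := Real.sq_sqrt (by linarith)
  have hns : (n : ℝ) ≤ n * √n := le_mul_of_one_le_right (by linarith) hs1
  have hnM : 2 * (n : ℝ) ≤ M := by nlinarith
  have hM0 : (0 : ℝ) < M := by linarith
  have hM1 : M ≠ 0 := by rintro rfl; simp at hM0
  have h := tv_sq_le (sum_Qs n hM1) (fun σ => le_Qs hM1 (by exact_mod_cast hnM) σ)
    (κ := 2 * (n : ℝ) ^ 3 / (M : ℝ) ^ 2) (by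
      have e : ∀ σ : Equiv.Perm (Fin n), Us n σ * (n * ((n + 1) / 2 - rSeq n σ) / M -
          2 * (n : ℝ) ^ 3 / (M : ℝ) ^ 2) = (n / M) * (Us n σ * (((n : ℝ) + 1) / 2 - rSeq n σ)) -
          Us n σ * (2 * (n : ℝ) ^ 3 / (M : ℝ) ^ 2) := fun σ => by ring
      simp_rw [e]
      rw [Finset.sum_sub_distrib, ← Finset.mul_sum, sum_Us_mul_rSeq hn, ← Finset.sum_mul, sum_Us]
      linarith)
  refine le_of_sq_le_sq ?_ (by positivity)
  refine h.trans ?_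
  have h1 : (L * (n * √n)) ^ 2 ≤ (M : ℝ) ^ 2 := pow_le_pow_left₀ (by positivity) hM 2
  have h2 : (L * (n * √n)) ^ 2 = L ^ 2 * (n : ℝ) ^ 3 := by
    rw [mul_pow, mul_pow, hs]; ring
  rw [h2] at h1
  rw [div_pow, div_le_div_iff₀ (by positivity) (by positivity)]
  nlinarith

/-- The permutations with atypically few rising sequences. -/
def fewRising (n : ℕ) (b : ℝ) : Finset (Equiv.Perm (Fin n)) :=
  Finset.univ.filter fun σ => (rSeq n σ : ℝ) ≤ (n + 1) / 2 - b * √n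

lemma sum_Us_fewRising_le {n : ℕ} (hn : 4 ≤ n) {b : ℝ} (hb : 0 ≤ b) :
    ∑ σ ∈ fewRising n b, Us n σ ≤ Real.exp (2 - b / 2) := by
  have hn1 : (4 : ℝ) ≤ n := by exact_mod_cast hn
  have hs : √(n : ℝ) ^ 2 = n := Real.sq_sqrt (by linarith)
  have hs2 : 2 ≤ √(n : ℝ) := Real.le_sqrt_of_sq_le (by linarith)
  set R : ℝ := n * √n with hR
  have hR2 : R ^ 2 = (n : ℝ) ^ 3 := by rw [hR, mul_pow, hs]; ring
  have hR1 : 2 * n ≤ R := by rw [hR]; nlinarith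
  obtain ⟨M, hM1, hM2⟩ : ∃ M : ℕ, R ≤ M ∧ (M : ℝ) ≤ 2 * R :=
    ⟨⌈R⌉₊, Nat.le_ceil R, by linarith [Nat.ceil_lt_add_one (show 0 ≤ R by linarith)]⟩
  have hM0 : (0 : ℝ) < M := by linarith
  have hMne : M ≠ 0 := by rintro rfl; simp at hM0
  have hnM : 2 * n ≤ M := by
    have : 2 * (n : ℝ) ≤ M := by linarith
    exact_mod_cast this
  have h1 : ∀ σ ∈ fewRising n b, Us n σ * Real.exp (b / 2 - 2) ≤ Qs n M σ := fun σ hσ => by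
    refine le_trans (mul_le_mul_of_nonneg_left (Real.exp_le_exp.2 ?_) (Us_pos n σ).le)
      (le_Qs hMne hnM σ)
    have hσ' := (Finset.mem_filter.1 hσ).2
    have h2 : b / 2 ≤ n * ((n + 1) / 2 - rSeq n σ) / M := by
      rw [le_div_iff₀ hM0]
      have : (n : ℝ) * (b * √n) ≤ n * ((n + 1) / 2 - rSeq n σ) :=
        mul_le_mul_of_nonneg_left (by linarith) (by linarith)
      have h3 : b * M ≤ b * (2 * R) := mul_le_mul_of_nonneg_left hM2 hb
      rw [hR] at h3
      nlinarith
    have h3 : 2 * (n : ℝ) ^ 3 / (M : ℝ) ^ 2 ≤ 2 := by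
      rw [div_le_iff₀ (by positivity), ← hR2]
      nlinarith
    linarith
  have h2 : ∑ σ ∈ fewRising n b, Qs n M σ ≤ 1 := by
    rw [← sum_Qs n hMne]
    exact Finset.sum_le_sum_of_subset_of_nonneg (Finset.subset_univ _) fun σ _ _ => Qs_nonneg n M σ
  have h3 := (Finset.sum_le_sum h1).trans h2
  rw [← Finset.sum_mul, ← le_div_iff₀ (Real.exp_pos _), one_div, ← Real.exp_neg, neg_sub] at h3
  exact h3

lemma one_sub_exp_le_sum_Qs_fewRising {n M : ℕ} {L : ℝ} (hn : 8 ≤ n) (hM : M ≠ 0) (hL : 0 ≤ L)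
    (hLn : L ≤ 1024 * √n) (hML : M * L ≤ n * √n) :
    1 - Real.exp (-(L ^ 2 / 4096)) ≤ ∑ σ ∈ fewRising n (L / 4096), Qs n M σ := by
  have hn1 : (8 : ℝ) ≤ n := by exact_mod_cast hn
  have hs : √(n : ℝ) ^ 2 = n := Real.sq_sqrt (by linarith)
  have hs0 : 0 ≤ √(n : ℝ) := Real.sqrt_nonneg _
  have hM0 : (0 : ℝ) < M := Nat.cast_pos.2 (Nat.pos_of_ne_zero hM)
  set z : ℝ := n * √n / M with hz
  have hz1 : L ≤ z := by rw [hz, le_div_iff₀ hM0]; linarith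
  have hz2 : (n : ℝ) ^ 3 / (2048 * (M : ℝ) ^ 2) = z ^ 2 / 2048 := by
    rw [hz, div_pow, mul_pow, hs]; field_simp
  have h1 : ∀ σ ∈ (fewRising n (L / 4096))ᶜ,
      Qs n M σ ≤ Us n σ * Real.exp (-(L ^ 2 / 4096)) := fun σ hσ => by
    have hσ' : ((n : ℝ) + 1) / 2 - L / 4096 * √n < rSeq n σ := by
      simpa [fewRising] using hσ
    have hr : (n : ℝ) / 4 ≤ rSeq n σ := by nlinarith
    refine (Qs_le hM hn hr).trans
      (mul_le_mul_of_nonneg_left (Real.exp_le_exp.2 ?_) (Us_pos n σ).le)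
    have h2 : n * ((n + 1) / 2 - rSeq n σ) / M ≤ L / 4096 * z := by
      rw [hz, ← mul_div_assoc]
      refine div_le_div_of_nonneg_right ?_ hM0.le
      have : (n : ℝ) * ((n + 1) / 2 - rSeq n σ) ≤ n * (L / 4096 * √n) :=
        mul_le_mul_of_nonneg_left (by linarith) (by linarith)
      linarith
    rw [hz2]
    nlinarith
  have h2 : ∑ σ ∈ (fewRising n (L / 4096))ᶜ, Qs n M σ ≤ Real.exp (-(L ^ 2 / 4096)) := by
    refine (Finset.sum_le_sum h1).trans ?_
    rw [← Finset.sum_mul]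
    refine mul_le_of_le_one_left (Real.exp_pos _).le ?_
    rw [← sum_Us n]
    exact Finset.sum_le_sum_of_subset_of_nonneg (Finset.subset_univ _) fun σ _ _ => (Us_pos n σ).le
  have h3 := Finset.sum_add_sum_compl (fewRising n (L / 4096)) (Qs n M)
  rw [sum_Qs n hM] at h3
  linarith

/-- A single event distinguishes the uniform distribution from all `M`-shuffles with `M` small
compared to `n ^ (3 / 2)`. -/
lemma exists_distinguishing_set {δ : ℝ} (hδ : 0 < δ) : ∃ L : ℝ, 1 ≤ L ∧ ∀ᶠ n : ℕ in atTop,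
    ∃ A : Finset (Equiv.Perm (Fin n)), ∑ σ ∈ A, Us n σ ≤ δ ∧
      ∀ M : ℕ, M ≠ 0 → M * L ≤ n * √n → 1 - δ ≤ ∑ σ ∈ A, Qs n M σ := by
  have t1 : Tendsto (fun L : ℝ => Real.exp (2 - L / 4096 / 2)) atTop (nhds 0) := by
    refine Real.tendsto_exp_atBot.comp ?_
    simp only [sub_eq_add_neg, div_eq_mul_inv]
    refine tendsto_atBot_add_const_left _ _ (tendsto_neg_atTop_atBot.comp ?_)
    exact (tendsto_id.atTop_mul_const (by norm_num)).atTop_mul_const (by norm_num)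
  have t2 : Tendsto (fun L : ℝ => Real.exp (-(L ^ 2 / 4096))) atTop (nhds 0) := by
    refine Real.tendsto_exp_atBot.comp (tendsto_neg_atTop_atBot.comp ?_)
    exact (tendsto_pow_atTop two_ne_zero).atTop_div_const (by norm_num)
  obtain ⟨L, h1, h2, h3⟩ := ((eventually_ge_atTop (1 : ℝ)).and
    ((t1.eventually (gt_mem_nhds hδ)).and (t2.eventually (gt_mem_nhds hδ)))).exists
  refine ⟨L, h1, ?_⟩
  have t3 : Tendsto (fun n : ℕ => 1024 * √(n : ℝ)) atTop atTop :=
    (Real.tendsto_sqrt_atTop.comp tendsto_natCast_atTop_atTop).const_mul_atTop (by norm_num)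
  filter_upwards [eventually_ge_atTop 8, t3.eventually_ge_atTop L] with n hn hLn
  refine ⟨fewRising n (L / 4096), (sum_Us_fewRising_le (by omega) (by positivity)).trans h2.le,
    fun M hM hML => ?_⟩
  exact (sub_le_sub_left h3.le 1).trans
    (one_sub_exp_le_sum_Qs_fewRising hn hM (by linarith) hLn hML)

/-- The critical time `3 log n / (2 log m)`. -/
def critTime (n m : ℕ) : ℝ := 3 * Real.log n / (2 * Real.log m)

lemma log_mul_sqrt_eq {n m : ℕ} (hn : n ≠ 0) (hm : 2 ≤ m) :
    Real.log (n * √n) = critTime n m * Real.log m := by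
  have hn0 : (0 : ℝ) < n := by exact_mod_cast Nat.pos_of_ne_zero hn
  have hm0 : Real.log m ≠ 0 := (Real.log_pos (by exact_mod_cast hm)).ne'
  rw [Real.log_mul hn0.ne' (Real.sqrt_pos.2 hn0).ne', Real.log_sqrt hn0.le, critTime]
  field_simp
  ring

lemma pow_mul_le_mul_sqrt {n m k : ℕ} {L a : ℝ} (hn : n ≠ 0) (hm : 2 ≤ m) (hL : 0 < L) (ha : 0 ≤ a)
    (hLa : Real.log L ≤ a * Real.log 2) (hk : (k : ℝ) ≤ critTime n m - a) :
    ((m ^ k : ℕ) : ℝ) * L ≤ n * √n := by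
  have hn0 : (0 : ℝ) < n := by exact_mod_cast Nat.pos_of_ne_zero hn
  have hm2 : (2 : ℝ) ≤ m := by exact_mod_cast hm
  have hlog : Real.log 2 ≤ Real.log m := Real.log_le_log (by norm_num) hm2
  have hlog2 : 0 < Real.log 2 := Real.log_pos (by norm_num)
  have hmk : (0 : ℝ) < (m : ℝ) ^ k := by positivity
  rw [← Real.log_le_log_iff (by push_cast; positivity) (mul_pos hn0 (Real.sqrt_pos.2 hn0)),
    log_mul_sqrt_eq hn hm, Nat.cast_pow, Real.log_mul hmk.ne' hL.ne', Real.log_pow]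
  nlinarith

lemma mul_sqrt_le_pow {n m k : ℕ} {L a : ℝ} (hn : n ≠ 0) (hm : 2 ≤ m) (hL : 0 < L) (ha : 0 ≤ a)
    (hLa : Real.log L ≤ a * Real.log 2) (hk : critTime n m + a ≤ k) :
    L * (n * √n) ≤ (m ^ k : ℕ) := by
  have hn0 : (0 : ℝ) < n := by exact_mod_cast Nat.pos_of_ne_zero hn
  have hm2 : (2 : ℝ) ≤ m := by exact_mod_cast hm
  have hlog : Real.log 2 ≤ Real.log m := Real.log_le_log (by norm_num) hm2
  have hlog2 : 0 < Real.log 2 := Real.log_pos (by norm_num)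
  have hmk : (0 : ℝ) < (m : ℝ) ^ k := by positivity
  have hnn : (0 : ℝ) < n * √n := mul_pos hn0 (Real.sqrt_pos.2 hn0)
  rw [Nat.cast_pow, ← Real.log_le_log_iff (mul_pos hL hnn) hmk, Real.log_mul hL.ne' hnn.ne',
    log_mul_sqrt_eq hn hm, Real.log_pow]
  nlinarith

lemma tv_Hm_le_poisP {δ : ℝ} (hδ : 0 < δ) : ∃ a : ℝ, 0 ≤ a ∧ ∀ n m : ℕ, n ≠ 0 → 2 ≤ m →
    ∀ t : ℝ, 0 ≤ t →
      tv n (Hm n m t) (Us n) ≤ poisP t {k | (k : ℝ) < critTime n m + a} + δ := by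
  have hL2 : 2 ≤ max 2 (2 / δ) := le_max_left _ _
  have hL0 : 0 < max 2 (2 / δ) := by linarith
  have hlog2 : 0 < Real.log 2 := Real.log_pos (by norm_num)
  refine ⟨Real.log (max 2 (2 / δ)) / Real.log 2,
    div_nonneg (Real.log_nonneg (by linarith)) hlog2.le, fun n m hn hm t ht => ?_⟩
  refine tv_Hm_le (by omega) ht hδ.le fun k hk => (tv_Qs_le hn hL2 (mul_sqrt_le_pow hn hm hL0
    (div_nonneg (Real.log_nonneg (by linarith)) hlog2.le) (div_mul_cancel₀ _ hlog2.ne').ge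
    (not_lt.1 hk))).trans ?_
  rw [div_le_iff₀ hL0, mul_comm, ← div_le_iff₀ hδ]
  exact le_max_right _ _

lemma poisP_le_tv_Hm {δ : ℝ} (hδ : 0 < δ) : ∃ a : ℝ, 0 ≤ a ∧ ∀ᶠ n : ℕ in atTop, ∀ m : ℕ, 2 ≤ m →
    ∀ t : ℝ, 0 ≤ t →
      poisP t {k | (k : ℝ) ≤ critTime n m - a} ≤ tv n (Hm n m t) (Us n) + δ := by
  obtain ⟨L, hL1, hL⟩ := exists_distinguishing_set (half_pos hδ)
  have hlog2 : 0 < Real.log 2 := Real.log_pos (by norm_num)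
  have ha : 0 ≤ Real.log L / Real.log 2 := div_nonneg (Real.log_nonneg hL1) hlog2.le
  refine ⟨Real.log L / Real.log 2, ha, ?_⟩
  filter_upwards [hL, eventually_ne_atTop 0] with n hn hn0 m hm t ht
  obtain ⟨A, hA, hA'⟩ := hn
  have hm0 : m ≠ 0 := by omega
  have h := le_tv_Hm (S := {k | (k : ℝ) ≤ critTime n m - Real.log L / Real.log 2}) hm0 ht A
    fun k hk => hA' (m ^ k) (pow_ne_zero k hm0) (pow_mul_le_mul_sqrt hn0 hm (by linarith) ha
      (div_mul_cancel₀ _ hlog2.ne').ge hk)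
  have h1 := poisP_mono ht
    (Set.subset_univ {k : ℕ | (k : ℝ) ≤ critTime n m - Real.log L / Real.log 2})
  rw [poisP_univ] at h1
  nlinarith

lemma poisP_lt_le {T t l a : ℝ} (hT : 1 ≤ T) (hl0 : 0 ≤ l) (hl : l ≤ √T) (ha : a ≤ l * √T)
    (ht : T + 3 * l * √T ≤ t) : poisP t {k | (k : ℝ) < T + a} ≤ Real.exp (1 - l) := by
  have hs : 1 ≤ √T := Real.one_le_sqrt.2 hT
  have hsq : √T * √T = T := Real.mul_self_sqrt (by linarith)
  have hls : 0 ≤ l * √T := mul_nonneg hl0 (by linarith)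
  have hR : √(T + 3 * l * √T) ≤ 2 * √T :=
    Real.sqrt_le_iff.2 ⟨by linarith, by nlinarith⟩
  refine le_trans (poisP_mono (by linarith) fun k (hk : (k : ℝ) < T + a) => ?_)
    (poisP_lower_tail (by linarith) ht)
  have := mul_le_mul_of_nonneg_left hR hl0
  change (k : ℝ) ≤ _
  linarith

lemma one_sub_exp_le_poisP_le {T t l a : ℝ} (hl0 : 0 ≤ l) (hT : 1 ≤ T - 2 * l * √T)
    (ha : a ≤ l * √T) (ht0 : 0 ≤ t) (ht : t ≤ T - 2 * l * √T) :
    1 - Real.exp (1 - l) ≤ poisP t {k | (k : ℝ) ≤ T - a} := by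
  have hls : 0 ≤ l * √T := mul_nonneg hl0 (Real.sqrt_nonneg _)
  have hR : √(T - 2 * l * √T) ≤ √T := Real.sqrt_le_sqrt (by linarith)
  have h := poisP_compl t {k | (k : ℝ) ≤ T - a}
  have h2 : poisP t {k | (k : ℝ) ≤ T - a}ᶜ ≤ Real.exp (1 - l) := by
    refine le_trans (poisP_mono ht0 fun k hk => ?_) (poisP_upper_tail hT ht0 ht)
    have hk' : T - a < (k : ℝ) := not_le.1 hk
    have := mul_le_mul_of_nonneg_left hR hl0
    change _ ≤ (k : ℝ)
    linarith
  linarith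

lemma exp_le_poisP_le_sub {T c : ℝ} (hc : 0 ≤ c) (hT : 1 ≤ T - 5 * √T) :
    Real.exp (-((c + 5) * (c + 9))) / 2 ≤ poisP (T + c * √T) {k | (k : ℝ) ≤ T - √T} := by
  have hs0 : 0 ≤ √T := Real.sqrt_nonneg T
  have hsq : √T * √T = T := Real.mul_self_sqrt (by linarith)
  have hcs : 0 ≤ c * √T := mul_nonneg hc hs0
  have hR : √(T - 5 * √T) ≤ √T := Real.sqrt_le_sqrt (by linarith)
  refine exp_le_poisP hT (by linarith) fun k hk => ?_
  obtain ⟨h1, h2⟩ := abs_lt.1 hk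
  refine ⟨show (k : ℝ) ≤ _ by linarith, ?_⟩
  rw [le_div_iff₀ (by linarith)]
  have h3 : -((c + 9) * √T) ≤ k - (T + c * √T) := by linarith
  have h4 := mul_le_mul_of_nonneg_left h3 (by positivity : 0 ≤ (c + 5) * √T)
  have h5 : 0 ≤ (c + 5) * (c + 9) * (c * √T) := by positivity
  have h6 : (c + 5) * √T * -((c + 9) * √T) = -((c + 5) * (c + 9) * T) := by
    linear_combination -((c + 5) * (c + 9)) * hsq
  have h7 : T + c * √T - (T - 5 * √T) = (c + 5) * √T := by ring
  rw [h7]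
  linarith

lemma poisP_lt_add_le {T c : ℝ} (hc : 0 ≤ c) (hT : 9 ≤ T) (hcT : T / 2 ≤ T - c * √T) :
    poisP (T - c * √T) {k | (k : ℝ) < T + √T} ≤
      1 - Real.exp (-(2 * ((c + 9) * (c + 17)))) / 2 := by
  have hs3 : 3 ≤ √T := Real.le_sqrt_of_sq_le (by linarith)
  have hsq : √T * √T = T := Real.mul_self_sqrt (by linarith)
  have hR : √(T + 9 * √T) ≤ 2 * √T :=
    Real.sqrt_le_iff.2 ⟨by linarith, by nlinarith⟩
  have h := poisP_compl (T - c * √T) {k | T + √T ≤ (k : ℝ)}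
  have h0 : ({k | (k : ℝ) < T + √T} : Set ℕ) = {k : ℕ | T + √T ≤ (k : ℝ)}ᶜ := by
    ext k; simp
  rw [h0, h]
  refine sub_le_sub_left (exp_le_poisP (s := T + 9 * √T) (by linarith) (by linarith)
    fun k hk => ?_) _
  obtain ⟨h1, h2⟩ := abs_lt.1 hk
  refine ⟨show _ ≤ (k : ℝ) by linarith, ?_⟩
  rw [le_div_iff₀ (by linarith)]
  have h3 : k - (T - c * √T) ≤ (c + 17) * √T := by linarith
  have h4 := mul_le_mul_of_nonneg_left h3 (by positivity : 0 ≤ (c + 9) * √T)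
  have h5 := mul_le_mul_of_nonneg_left hcT (by positivity : 0 ≤ 2 * ((c + 9) * (c + 17)))
  have h6 : (c + 9) * √T * ((c + 17) * √T) = (c + 9) * (c + 17) * T := by
    linear_combination (c + 9) * (c + 17) * hsq
  have h7 : T - c * √T - (T + 9 * √T) = -((c + 9) * √T) := by ring
  rw [h7]
  linarith

lemma exp_neg_sub_le_tv_Hm {n m : ℕ} (hm : m ≠ 0) {t : ℝ} (ht : 0 ≤ t) :
    Real.exp (-t) - (n.factorial : ℝ)⁻¹ ≤ tv n (Hm n m t) (Us n) := by
  have h := le_tv_Hm (n := n) (S := {0}) (δ := 0) hm ht {1} fun k hk => by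
    rw [Set.mem_singleton_iff.1 hk]
    simp [Qs_one]
  have h1 : poisP t {0} = Real.exp (-t) := by
    rw [poisP, tsum_eq_single 0 fun k hk => by simp [hk]]
    simp [pois]
  rw [h1] at h
  simpa [Us] using h

section Limits

variable {m : ℕ → ℕ}

lemma tendsto_critTime
    (h : Tendsto (fun n : ℕ => Real.log n / Real.log (m n)) atTop atTop) :
    Tendsto (fun n => critTime n (m n)) atTop atTop := by
  refine (h.const_mul_atTop (by norm_num : (0 : ℝ) < 3 / 2)).congr fun n => ?_
  rw [critTime, mul_div_mul_comm]

lemma tendsto_exp_one_sub_mul {T : ℕ → ℝ} (hT : Tendsto T atTop atTop) {b : ℝ} (hb : 0 < b) :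
    Tendsto (fun n => Real.exp (1 - b * √(T n))) atTop (nhds 0) := by
  refine Real.tendsto_exp_atBot.comp ?_
  simp only [sub_eq_add_neg]
  exact tendsto_atBot_add_const_left _ _ (tendsto_neg_atTop_atBot.comp
    ((Real.tendsto_sqrt_atTop.comp hT).const_mul_atTop hb))

lemma tendsto_tv_zero_of_le (hm : ∀ n, 2 ≤ m n)
    (hT : Tendsto (fun n => critTime n (m n)) atTop atTop) {ε : ℝ} (hε : ε ∈ Set.Ioo (0 : ℝ) 1)
    {u : ℕ → ℝ} (hu : ∀ᶠ n in atTop, (1 + ε) * critTime n (m n) ≤ u n) :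
    Tendsto (fun n => tv n (Hm n (m n) (u n)) (Us n)) atTop (nhds 0) := by
  obtain ⟨hε0, hε1⟩ := hε
  refine tendsto_order.2 ⟨fun b hb => Eventually.of_forall fun n => hb.trans_le (tv_nonneg _ _ _),
    fun b hb => ?_⟩
  obtain ⟨a, -, ha⟩ := tv_Hm_le_poisP (half_pos hb)
  filter_upwards [hu, eventually_ne_atTop 0, hT.eventually_ge_atTop 1,
    hT.eventually_ge_atTop (a / (ε / 3)),
    (tendsto_exp_one_sub_mul hT (by linarith : 0 < ε / 3)).eventually_lt_const (half_pos hb)]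
    with n hn hn0 hT1 hTa hexp
  have hsq : √(critTime n (m n)) * √(critTime n (m n)) = critTime n (m n) :=
    Real.mul_self_sqrt (by linarith)
  have hs0 := Real.sqrt_nonneg (critTime n (m n))
  rw [div_le_iff₀ (by linarith)] at hTa
  refine (ha n (m n) hn0 (hm n) (u n) (by nlinarith)).trans_lt ?_
  have := poisP_lt_le (t := u n) (a := a) (l := ε / 3 * √(critTime n (m n))) hT1 (by positivity)
    (by nlinarith) (by rw [mul_assoc, hsq]; linarith) (by nlinarith)
  linarith

lemma tendsto_tv_one_of_le (hm : ∀ n, 2 ≤ m n)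
    (hT : Tendsto (fun n => critTime n (m n)) atTop atTop) {ε : ℝ} (hε : ε ∈ Set.Ioo (0 : ℝ) 1)
    {u : ℕ → ℝ} (hu0 : ∀ n, 0 ≤ u n) (hu : ∀ᶠ n in atTop, u n ≤ (1 - ε) * critTime n (m n)) :
    Tendsto (fun n => tv n (Hm n (m n) (u n)) (Us n)) atTop (nhds 1) := by
  obtain ⟨hε0, hε1⟩ := hε
  refine tendsto_order.2 ⟨fun b hb => ?_, fun b hb => Eventually.of_forall fun n =>
    (tv_Hm_le_one (by have := hm n; omega) (hu0 n)).trans_lt hb⟩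
  have hb' : 0 < (1 - b) / 2 := by linarith
  obtain ⟨a, -, ha⟩ := poisP_le_tv_Hm hb'
  filter_upwards [hu, ha, hT.eventually_ge_atTop (1 / (1 - ε)),
    hT.eventually_ge_atTop (a / (ε / 2)), hT.eventually_ge_atTop 0,
    (tendsto_exp_one_sub_mul hT (half_pos hε0)).eventually_lt_const hb']
    with n hn ha hT1 hTa hT0 hexp
  have hsq : √(critTime n (m n)) * √(critTime n (m n)) = critTime n (m n) :=
    Real.mul_self_sqrt hT0
  have hs0 := Real.sqrt_nonneg (critTime n (m n))
  rw [div_le_iff₀ (by linarith)] at hTa hT1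
  have h1 := ha (m n) (hm n) (u n) (hu0 n)
  have := one_sub_exp_le_poisP_le (t := u n) (a := a) (T := critTime n (m n))
    (l := ε / 2 * √(critTime n (m n))) (by positivity)
    (by nlinarith) (by rw [mul_assoc, hsq]; linarith) (hu0 n) (by nlinarith)
  linarith

lemma eventually_tv_add_le (hm : ∀ n, 2 ≤ m n)
    (hT : Tendsto (fun n => critTime n (m n)) atTop atTop) {c δ : ℝ} (hc : 0 < c) (hδ : 0 < δ) :
    ∀ᶠ n in atTop, tv n (Hm n (m n) (critTime n (m n) + c * √(critTime n (m n)))) (Us n) ≤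
      Real.exp (1 - c / 3) + δ := by
  obtain ⟨a, -, ha⟩ := tv_Hm_le_poisP hδ
  have hs := Real.tendsto_sqrt_atTop.comp hT
  filter_upwards [eventually_ne_atTop 0, hT.eventually_ge_atTop 1,
    hs.eventually_ge_atTop (c / 3), hs.eventually_ge_atTop (a / (c / 3))] with n hn0 hT1 hc3 hTa
  have hs0 := Real.sqrt_nonneg (critTime n (m n))
  rw [div_le_iff₀ (by linarith)] at hTa
  refine (ha n (m n) hn0 (hm n) _ (by positivity)).trans ?_
  have := poisP_lt_le (t := critTime n (m n) + c * √(critTime n (m n))) (a := a) (l := c / 3) hT1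
    (by positivity) hc3 (by rw [mul_comm]; exact hTa) (by linarith)
  linarith

lemma eventually_mul_sqrt_le {T : ℕ → ℝ} (hT : Tendsto T atTop atTop) (c : ℝ) :
    ∀ᶠ n in atTop, c * √(T n) ≤ T n / 2 := by
  filter_upwards [hT.eventually_ge_atTop 0,
    (Real.tendsto_sqrt_atTop.comp hT).eventually_ge_atTop (2 * c)] with n h0 hn
  change 2 * c ≤ √(T n) at hn
  nlinarith [Real.mul_self_sqrt h0, Real.sqrt_nonneg (T n)]

lemma eventually_le_tv_sub (hm : ∀ n, 2 ≤ m n)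
    (hT : Tendsto (fun n => critTime n (m n)) atTop atTop) {c δ : ℝ} (hc : 0 < c) (hδ : 0 < δ) :
    ∀ᶠ n in atTop, 1 - Real.exp (1 - c / 2) - δ ≤
      tv n (Hm n (m n) (max (critTime n (m n) - c * √(critTime n (m n))) 0)) (Us n) := by
  obtain ⟨a, -, ha⟩ := poisP_le_tv_Hm hδ
  have hs := Real.tendsto_sqrt_atTop.comp hT
  filter_upwards [ha, hT.eventually_ge_atTop 2, eventually_mul_sqrt_le hT c,
    hs.eventually_ge_atTop (a / (c / 2))] with n ha hT2 hcT hTa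
  rw [div_le_iff₀ (by linarith)] at hTa
  rw [max_eq_left (by linarith)]
  have h1 := ha (m n) (hm n) (critTime n (m n) - c * √(critTime n (m n))) (by linarith)
  have := one_sub_exp_le_poisP_le (t := critTime n (m n) - c * √(critTime n (m n))) (a := a)
    (T := critTime n (m n)) (l := c / 2) (by positivity) (by linarith)
    (by rw [mul_comm]; exact hTa) (by linarith) (by linarith)
  linarith

lemma eventually_le_tv_add (hm : ∀ n, 2 ≤ m n)
    (hT : Tendsto (fun n => critTime n (m n)) atTop atTop) {c δ : ℝ} (hc : 0 < c) (hδ : 0 < δ) :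
    ∀ᶠ n in atTop, Real.exp (-((c + 5) * (c + 9))) / 2 - δ ≤
      tv n (Hm n (m n) (critTime n (m n) + c * √(critTime n (m n)))) (Us n) := by
  obtain ⟨a, -, ha⟩ := poisP_le_tv_Hm hδ
  filter_upwards [ha, hT.eventually_ge_atTop 2, eventually_mul_sqrt_le hT 5,
    (Real.tendsto_sqrt_atTop.comp hT).eventually_ge_atTop a] with n ha hT2 h5 hTa
  have ht : 0 ≤ critTime n (m n) + c * √(critTime n (m n)) := by positivity
  have h1 := ha (m n) (hm n) _ ht
  have h2 := exp_le_poisP_le_sub (T := critTime n (m n)) hc.le (by linarith)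
  have h3 := poisP_mono ht (S := {k | (k : ℝ) ≤ critTime n (m n) - √(critTime n (m n))})
    (R := {k | (k : ℝ) ≤ critTime n (m n) - a})
    fun k hk => le_trans (show (k : ℝ) ≤ _ from hk) (sub_le_sub_left hTa _)
  linarith

lemma eventually_tv_sub_le (hm : ∀ n, 2 ≤ m n)
    (hT : Tendsto (fun n => critTime n (m n)) atTop atTop) {c δ : ℝ} (hc : 0 < c) (hδ : 0 < δ) :
    ∀ᶠ n in atTop,
      tv n (Hm n (m n) (max (critTime n (m n) - c * √(critTime n (m n))) 0)) (Us n) ≤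
        1 - Real.exp (-(2 * ((c + 9) * (c + 17)))) / 2 + δ := by
  obtain ⟨a, -, ha⟩ := tv_Hm_le_poisP hδ
  filter_upwards [eventually_ne_atTop 0, hT.eventually_ge_atTop 9, eventually_mul_sqrt_le hT c,
    (Real.tendsto_sqrt_atTop.comp hT).eventually_ge_atTop a] with n hn0 hT9 hcT hTa
  rw [max_eq_left (by linarith)]
  have ht : 0 ≤ critTime n (m n) - c * √(critTime n (m n)) := by linarith
  have h1 := ha n (m n) hn0 (hm n) _ ht
  have h2 := poisP_lt_add_le hc.le hT9 (by linarith)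
  have h3 := poisP_mono ht (S := {k | (k : ℝ) < critTime n (m n) + a})
    (R := {k | (k : ℝ) < critTime n (m n) + √(critTime n (m n))})
    fun k hk => lt_of_lt_of_le (show (k : ℝ) < _ from hk) (add_le_add_right hTa _)
  linarith

lemma tendsto_of_exists_cutoff (hm : ∀ n, 2 ≤ m n) {s : ℕ → ℝ} (hs : ∀ n, 0 < s n)
    (hup : Tendsto (fun n => tv n (Hm n (m n) (3 / 2 * s n)) (Us n)) atTop (nhds 0))
    (hlow : Tendsto (fun n => tv n (Hm n (m n) (1 / 2 * s n)) (Us n)) atTop (nhds 1)) :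
    Tendsto (fun n : ℕ => Real.log n / Real.log (m n)) atTop atTop := by
  have hm0 : ∀ n, m n ≠ 0 := fun n => by have := hm n; omega
  have hfac : Tendsto (fun n : ℕ => ((n.factorial : ℕ) : ℝ)⁻¹) atTop (nhds 0) :=
    tendsto_inv_atTop_zero.comp (tendsto_natCast_atTop_atTop.comp
      (tendsto_atTop_mono Nat.self_le_factorial tendsto_id))
  have hexp : Tendsto (fun n => Real.exp (-(3 / 2 * s n))) atTop (nhds 0) := by
    refine squeeze_zero (fun n => (Real.exp_pos _).le) (fun n => ?_)
      (by simpa using hup.add hfac)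
    have := exp_neg_sub_le_tv_Hm (n := n) (hm0 n) (by linarith [hs n] : 0 ≤ 3 / 2 * s n)
    linarith
  have hs_top : Tendsto (fun n => 1 / 2 * s n) atTop atTop := by
    rw [Real.tendsto_exp_comp_nhds_zero, tendsto_neg_atBot_iff] at hexp
    refine (hexp.const_mul_atTop (by norm_num : (0 : ℝ) < 1 / 3)).congr fun n => by ring
  obtain ⟨a, -, ha⟩ := tv_Hm_le_poisP (by norm_num : (0 : ℝ) < 1 / 4)
  refine tendsto_atTop.2 fun C => ?_
  filter_upwards [eventually_ne_atTop 0, hs_top.eventually_ge_atTop 1,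
    hs_top.eventually_ge_atTop (2 * (3 / 2 * C + a)),
    (tendsto_exp_one_sub_mul hs_top (by norm_num : (0 : ℝ) < 1 / 2)).eventually_lt_const
      (by norm_num : (0 : ℝ) < 1 / 4),
    hlow.eventually_const_lt (by norm_num : (1 / 2 : ℝ) < 1)] with n hn0 h1 h2 h3 h4
  by_contra! hC
  have hT : critTime n (m n) ≤ 3 / 2 * C := by
    rw [critTime, mul_div_mul_comm]; linarith
  have h5 := ha n (m n) hn0 (hm n) (1 / 2 * s n) (by linarith)
  have h6 := poisP_lower_tail (l := 1 / 2 * √(1 / 2 * s n)) h1 le_rfl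
  have h7 := poisP_mono (by linarith : 0 ≤ 1 / 2 * s n)
    (S := {k | (k : ℝ) < critTime n (m n) + a})
    (R := {k | (k : ℝ) ≤ 1 / 2 * s n - 1 / 2 * √(1 / 2 * s n) * √(1 / 2 * s n)})
    fun k hk => by
      have hk' : (k : ℝ) < _ := hk
      change (k : ℝ) ≤ _
      rw [mul_assoc, Real.mul_self_sqrt (by linarith)]
      linarith
  linarith

end Limits

section LimsupBounds

variable {f : ℕ → ℝ}

lemma limsup_le_of_eventually_le_add (h0 : ∀ n, 0 ≤ f n) {b : ℝ}
    (h : ∀ δ, 0 < δ → ∀ᶠ n in atTop, f n ≤ b + δ) : limsup f atTop ≤ b :=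
  le_of_forall_pos_le_add fun δ hδ =>
    limsup_le_of_le (isCoboundedUnder_le_of_le atTop h0) (h δ hδ)

lemma limsup_nonneg (h0 : ∀ n, 0 ≤ f n) {b : ℝ} (h : ∀ᶠ n in atTop, f n ≤ b) :
    0 ≤ limsup f atTop :=
  le_limsup_of_frequently_le (Eventually.of_forall h0).frequently ⟨b, h⟩

lemma le_liminf_of_eventually_sub_le (h1 : ∀ᶠ n in atTop, f n ≤ 1) {b : ℝ}
    (h : ∀ δ, 0 < δ → ∀ᶠ n in atTop, b - δ ≤ f n) : b ≤ liminf f atTop :=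
  le_of_forall_pos_le_add fun δ hδ => sub_le_iff_le_add.1 <|
    le_liminf_of_le (isCoboundedUnder_ge_of_eventually_le atTop h1) (h δ hδ)

lemma liminf_le_one (h0 : ∀ n, 0 ≤ f n) (h1 : ∀ᶠ n in atTop, f n ≤ 1) : liminf f atTop ≤ 1 :=
  liminf_le_of_frequently_le h1.frequently ⟨0, eventually_map.2 (Eventually.of_forall h0)⟩

end LimsupBounds

lemma tendsto_exp_one_sub_div {b : ℝ} (hb : 0 < b) :
    Tendsto (fun c : ℝ => Real.exp (1 - c / b)) atTop (nhds 0) := by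
  refine Real.tendsto_exp_atBot.comp ?_
  simp only [sub_eq_add_neg]
  exact tendsto_atBot_add_const_left _ _ (tendsto_neg_atTop_atBot.comp
    (tendsto_id.atTop_div_const hb))

/-- Continuous-time `m_n`-shuffles: a total variation cutoff (at some critical times)
exists iff `log n / log m_n → ∞`, in which case there is an optimal
`(t_n, √t_n)` cutoff with `t_n = 3 log n / (2 log m_n)`. -/
theorem continuous_time_m_shuffle_cutoff (m : ℕ → ℕ) (hm : ∀ n, 2 ≤ m n) :
    ((∃ s : ℕ → ℝ, (∀ n, 0 < s n) ∧ ∀ ε : ℝ, ε ∈ Set.Ioo (0 : ℝ) 1 →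
        (∀ u : ℕ → ℝ, (∀ n, (1 + ε) * s n ≤ u n) →
          Filter.Tendsto (fun n => tv n (Hm n (m n) (u n)) (Us n))
            Filter.atTop (nhds 0)) ∧
        (∀ u : ℕ → ℝ, (∀ n, 0 ≤ u n ∧ u n ≤ (1 - ε) * s n) →
          Filter.Tendsto (fun n => tv n (Hm n (m n) (u n)) (Us n))
            Filter.atTop (nhds 1))) ↔
      Filter.Tendsto (fun n : ℕ => Real.log n / Real.log (m n))
        Filter.atTop Filter.atTop) ∧
    (Filter.Tendsto (fun n : ℕ => Real.log n / Real.log (m n))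
        Filter.atTop Filter.atTop →
      Filter.Tendsto (fun c : ℝ =>
        Filter.limsup (fun n : ℕ =>
          tv n (Hm n (m n) (3 * Real.log n / (2 * Real.log (m n)) +
            c * Real.sqrt (3 * Real.log n / (2 * Real.log (m n))))) (Us n))
          Filter.atTop) Filter.atTop (nhds 0) ∧
      Filter.Tendsto (fun c : ℝ =>
        Filter.liminf (fun n : ℕ =>
          tv n (Hm n (m n) (max (3 * Real.log n / (2 * Real.log (m n)) -
            c * Real.sqrt (3 * Real.log n / (2 * Real.log (m n)))) 0)) (Us n))
          Filter.atTop) Filter.atTop (nhds 1) ∧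
      (∀ c : ℝ, 0 < c →
        0 < Filter.liminf (fun n : ℕ =>
              tv n (Hm n (m n) (3 * Real.log n / (2 * Real.log (m n)) +
                c * Real.sqrt (3 * Real.log n / (2 * Real.log (m n))))) (Us n))
              Filter.atTop ∧
        Filter.limsup (fun n : ℕ =>
              tv n (Hm n (m n) (max (3 * Real.log n / (2 * Real.log (m n)) -
                c * Real.sqrt (3 * Real.log n / (2 * Real.log (m n)))) 0)) (Us n))
              Filter.atTop < 1)) := by
  have hm0 : ∀ n, m n ≠ 0 := fun n => by have := hm n; omega
  have hcrit : ∀ n, 0 ≤ critTime n (m n) := fun n =>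
    div_nonneg (mul_nonneg (by norm_num) (Real.log_natCast_nonneg _))
      (mul_nonneg (by norm_num) (Real.log_natCast_nonneg _))
  refine ⟨⟨?_, fun h => ?_⟩, fun h => ?_⟩
  · rintro ⟨s, hs, h⟩
    obtain ⟨hup, hlow⟩ := h (1 / 2) ⟨by norm_num, by norm_num⟩
    exact tendsto_of_exists_cutoff hm hs
      (hup _ fun n => le_of_eq (by ring))
      (hlow _ fun n => ⟨by linarith [hs n], le_of_eq (by ring)⟩)
  · have hT := tendsto_critTime h
    have hev : ∀ᶠ n in atTop, critTime n (m n) =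
        if 0 < critTime n (m n) then critTime n (m n) else 1 := by
      filter_upwards [hT.eventually_gt_atTop 0] with n hn
      rw [if_pos hn]
    refine ⟨fun n => if 0 < critTime n (m n) then critTime n (m n) else 1, fun n => ?_,
      fun ε hε => ⟨fun u hu => ?_, fun u hu => ?_⟩⟩
    · dsimp only
      split_ifs with h0
      exacts [h0, one_pos]
    · refine tendsto_tv_zero_of_le hm hT hε ?_
      filter_upwards [hev] with n hn
      rw [hn]
      exact hu n
    · refine tendsto_tv_one_of_le hm hT hε (fun n => (hu n).1) ?_
      filter_upwards [hev] with n hn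
      rw [hn]
      exact (hu n).2
  · have hT := tendsto_critTime h
    have heq : ∀ n : ℕ, 3 * Real.log n / (2 * Real.log (m n)) = critTime n (m n) := fun _ => rfl
    simp only [heq]
    have hadd : ∀ c : ℝ, 0 < c → ∀ᶠ n in atTop,
        tv n (Hm n (m n) (critTime n (m n) + c * √(critTime n (m n)))) (Us n) ≤ 1 := fun c hc =>
      Eventually.of_forall fun n => tv_Hm_le_one (hm0 n)
        (add_nonneg (hcrit n) (mul_nonneg hc.le (Real.sqrt_nonneg _)))
    have hsub : ∀ c : ℝ, ∀ᶠ n in atTop,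
        tv n (Hm n (m n) (max (critTime n (m n) - c * √(critTime n (m n))) 0)) (Us n) ≤ 1 :=
      fun c => Eventually.of_forall fun n => tv_Hm_le_one (hm0 n) (le_max_right _ _)
    refine ⟨?_, ?_, fun c hc => ⟨?_, ?_⟩⟩
    · refine tendsto_of_tendsto_of_tendsto_of_le_of_le' tendsto_const_nhds
        (tendsto_exp_one_sub_div (by norm_num : (0 : ℝ) < 3)) ?_ ?_
      · filter_upwards [eventually_gt_atTop 0] with c hc
        exact limsup_nonneg (fun n => tv_nonneg _ _ _) (hadd c hc)
      · filter_upwards [eventually_gt_atTop 0] with c hc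
        exact limsup_le_of_eventually_le_add (fun n => tv_nonneg _ _ _)
          fun δ hδ => eventually_tv_add_le hm hT hc hδ
    · refine tendsto_of_tendsto_of_tendsto_of_le_of_le'
        (by simpa using (tendsto_exp_one_sub_div (by norm_num : (0 : ℝ) < 2)).const_sub 1)
        tendsto_const_nhds ?_ ?_
      · filter_upwards [eventually_gt_atTop 0] with c hc
        exact le_liminf_of_eventually_sub_le (hsub c)
          fun δ hδ => eventually_le_tv_sub hm hT hc hδ
      · exact Eventually.of_forall fun c => liminf_le_one (fun n => tv_nonneg _ _ _) (hsub c)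
    · refine lt_of_lt_of_le ?_ (le_liminf_of_eventually_sub_le (hadd c hc)
        fun δ hδ => eventually_le_tv_add hm hT hc hδ)
      positivity
    · refine lt_of_le_of_lt (limsup_le_of_eventually_le_add (fun n => tv_nonneg _ _ _)
        fun δ hδ => eventually_tv_sub_le hm hT hc hδ) ?_
      have : 0 < Real.exp (-(2 * ((c + 9) * (c + 17)))) / 2 := by positivity
      linarith
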